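/- Let (X_i)_{i=1}^𝔪 be a sequence of infinite-dimensional separable purely atomic Banach lattices satisfying (⋆) for the same constant μ, let 𝐞 be a 1-unconditional basis with 𝔪 terms, and let X := (⊕_i X_i)_𝐞 (such X is order complete, so ℒʳ(X) is a Banach lattice algebra). Let (x_i) be a shrinking basis for X satisfying (⋆) with constant μ in each summand, with biorthogonal functionals (x_i*), q_i := x_i*⊗x_i and e_n := ∑_{i=1}^n q_i. Let 𝔛 be a Banach lattice 𝒜ʳ(X)-module such that the sequences (x·e_n) and (e_n·x) converge in norm for every x ∈ 𝔛. Suppose further that either 𝔛 contains no complemented subspace isomorphic to ℓ₁, or X is reflexive and dim(q_i·𝔛′·q_j) < ∞ for all i, j ∈ ℕ. Then every bounded derivation D : 𝒜ʳ(X) → 𝔛′ is regular. -/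

import Mathlib

/- STATEMENT 7 (Corollary cor3): every bounded derivation from 𝒜ʳ(X) into the dual
   of a Banach lattice 𝒜ʳ(X)-module 𝔛 in which (x·e_n) and (e_n·x) converge in norm,
   is regular, provided either 𝔛 has no complemented copy of ℓ₁, or X is reflexive
   and the corner spaces q_i·𝔛′·q_j are finite dimensional. -/

open Filter Topology

section Prelude

variable {X 𝔛 : Type*} [NormedAddCommGroup X] [Lattice X] [HasSolidNorm X] [IsOrderedAddMonoid X] [NormedSpace ℝ X]
variable [NormedAddCommGroup 𝔛] [Lattice 𝔛] [HasSolidNorm 𝔛] [IsOrderedAddMonoid 𝔛] [NormedSpace ℝ 𝔛]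

/-- A bounded operator is positive if it maps the positive cone into itself. -/
def IsPosOp (T : X →L[ℝ] X) : Prop := ∀ x : X, 0 ≤ x → 0 ≤ T x

/-- The operator order on regular operators. -/
def opLe (S T : X →L[ℝ] X) : Prop := IsPosOp (T - S)

/-- ℒʳ(X): the regular operators, i.e. linear combinations of positive operators. -/
def LrSet (X : Type*) [NormedAddCommGroup X] [Lattice X] [HasSolidNorm X] [IsOrderedAddMonoid X] [NormedSpace ℝ X] :
    Set (X →L[ℝ] X) :=
  {T | ∃ (n : ℕ) (c : Fin n → ℝ) (S : Fin n → X →L[ℝ] X),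
    (∀ i, IsPosOp (S i)) ∧ T = ∑ i, c i • S i}

/-- The regular norm ‖T‖ᵣ = inf{‖S‖ : |Tx| ≤ S|x| for all x}. -/
noncomputable def rnorm (T : X →L[ℝ] X) : ℝ :=
  sInf {c : ℝ | ∃ S : X →L[ℝ] X, ‖S‖ = c ∧ ∀ x : X, |T x| ≤ S |x|}

/-- ℱ(X): continuous finite-rank operators. -/
def FinRankOp (T : X →L[ℝ] X) : Prop :=
  ∃ (n : ℕ) (f : Fin n → X →L[ℝ] ℝ) (v : Fin n → X), T = ∑ i, (f i).smulRight (v i)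

/-- 𝒜ʳ(X): the ‖·‖ᵣ-closure of ℱ(X) in ℒʳ(X). -/
def ArSet (X : Type*) [NormedAddCommGroup X] [Lattice X] [HasSolidNorm X] [IsOrderedAddMonoid X] [NormedSpace ℝ X] :
    Set (X →L[ℝ] X) :=
  {T | T ∈ LrSet X ∧ ∀ ε : ℝ, 0 < ε → ∃ F : X →L[ℝ] X, FinRankOp F ∧ rnorm (T - F) < ε}

/-- x is a normalized atom of the Banach lattice X. -/
def IsNormAtom (a : X) : Prop :=
  0 < a ∧ ‖a‖ = 1 ∧ ∀ y : X, 0 ≤ y → y ≤ a → ∃ c : ℝ, y = c • a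

/-- The dual (pointwise-on-the-cone) order on 𝔛′ = 𝔛 →L[ℝ] ℝ. -/
def dualLe (f g : 𝔛 →L[ℝ] ℝ) : Prop := ∀ y : 𝔛, 0 ≤ y → f y ≤ g y

/-- Least upper bound with respect to the dual order. -/
def dualIsLUB (S : Set (𝔛 →L[ℝ] ℝ)) (f : 𝔛 →L[ℝ] ℝ) : Prop :=
  (∀ g ∈ S, dualLe g f) ∧ ∀ h : 𝔛 →L[ℝ] ℝ, (∀ g ∈ S, dualLe g h) → dualLe f h

/-- A subset of the dual is weak*-closed. -/
def wstarClosed (S : Set (𝔛 →L[ℝ] ℝ)) : Prop :=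
  IsClosed (StrongDual.toWeakDual '' S)

/-- (y i)_{i<n} and (z i)_{i<n} are L-equivalent. -/
def seqEquivUpTo (L : ℝ) (n : ℕ) (y z : ℕ → X) : Prop :=
  ∀ α : ℕ → ℝ,
    ‖∑ i ∈ Finset.range n, α i • y i‖ ≤ L * ‖∑ i ∈ Finset.range n, α i • z i‖ ∧
    ‖∑ i ∈ Finset.range n, α i • z i‖ ≤ L * ‖∑ i ∈ Finset.range n, α i • y i‖

/-- The sequence (x i) satisfies the selection property (⋆) with constant μ. -/
def StarSeq (μ : ℝ) (x : ℕ → X) : Prop :=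
  ∃ μs : ℕ → ℝ, (∀ n, 1 ≤ μs n ∧ μs n ≤ μ) ∧
    ∀ (n : ℕ) (l : ℕ → ℕ), 0 < n → (∀ i j, i < j → j < n → l i < l j) →
      seqEquivUpTo (μs n) n x (fun i => x (l i)) →
      ∀ k : ℕ, ∃ m : ℕ, l (n - 1) + k ≤ m ∧
        seqEquivUpTo (μs (n + 1)) (n + 1) x (fun i => x (Function.update l n m i))

/-- (x i) is (an enumeration of the normalized atoms of X forming) a basis for
X = (⊕_n X_n)_𝐞 satisfying (⋆) with constant μ in each summand: there is a partition
of ℕ into slices (ψ n ·), n ∈ I, order preserving on each slice, such that on each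
slice the (⋆)-property holds with constant μ, the slices are pairwise disjoint
sublattices, and the decomposition into slices is 1-unconditional. -/
def StarSummandBasis (μ : ℝ) (x : ℕ → X) : Prop :=
  ∃ (I : Set ℕ) (ψ : ℕ → ℕ → ℕ),
    (∀ n ∈ I, StrictMono (ψ n)) ∧
    (∀ i : ℕ, ∃! p : ℕ × ℕ, p.1 ∈ I ∧ ψ p.1 p.2 = i) ∧
    (∀ n ∈ I, StarSeq μ (fun j => x (ψ n j))) ∧
    (∀ i, IsNormAtom (x i)) ∧
    (∀ a : X, IsNormAtom a → ∃ i, x i = a) ∧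
    (∀ n ∈ I, ∀ m ∈ I, n ≠ m → ∀ j j' : ℕ, x (ψ n j) ⊓ x (ψ m j') = 0) ∧
    (∀ (s : Finset ℕ) (α ε : ℕ → ℝ),
      (∀ n ∈ I, ∀ j j' : ℕ, ε (ψ n j) = ε (ψ n j')) → (∀ i, |ε i| ≤ 1) →
      ‖∑ i ∈ s, (ε i * α i) • x i‖ ≤ ‖∑ i ∈ s, α i • x i‖)

/-- A sequence in the dual is equivalent to the unit vector basis of c₀. -/
def EquivC0Basis (ξ : ℕ → (𝔛 →L[ℝ] ℝ)) : Prop :=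
  ∃ L : ℝ, 0 < L ∧ ∀ (m : ℕ) (α : ℕ → ℝ),
    (∀ j < m, |α j| ≤ L * ‖∑ i ∈ Finset.range m, α i • ξ i‖) ∧
    (∀ B : ℝ, 0 ≤ B → (∀ i < m, |α i| ≤ B) →
      ‖∑ i ∈ Finset.range m, α i • ξ i‖ ≤ L * B)

/-- A map D defined (at least) on A ⊆ ℒʳ(X), with values in 𝔛′, is regular if on A it
is a finite linear combination of positive linear maps. -/
def RegularDerivOn (A : Set (X →L[ℝ] X)) (D : (X →L[ℝ] X) → (𝔛 →L[ℝ] ℝ)) : Prop :=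
  ∃ (n : ℕ) (c : Fin n → ℝ) (P : Fin n → (X →L[ℝ] X) → (𝔛 →L[ℝ] ℝ)),
    (∀ t, (∀ a ∈ A, ∀ b ∈ A, P t (a + b) = P t a + P t b) ∧
          (∀ (r : ℝ), ∀ a ∈ A, P t (r • a) = r • P t a) ∧
          (∀ a ∈ A, IsPosOp a → dualLe 0 (P t a))) ∧
    ∀ a ∈ A, D a = ∑ t, c t • P t a

/-- 𝔛 contains a complemented subspace isomorphic to ℓ₁. -/
def HasComplementedL1 (𝔛 : Type*) [NormedAddCommGroup 𝔛] [Lattice 𝔛] [HasSolidNorm 𝔛] [IsOrderedAddMonoid 𝔛] [NormedSpace ℝ 𝔛] :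
    Prop :=
  ∃ (P : 𝔛 →L[ℝ] 𝔛) (e : ℕ → 𝔛) (L : ℝ), 0 < L ∧ P ∘L P = P ∧
    (∀ y : 𝔛, P y ∈ closure (Submodule.span ℝ (Set.range e) : Set 𝔛)) ∧
    (∀ i, P (e i) = e i) ∧
    (∀ (m : ℕ) (α : ℕ → ℝ),
      L⁻¹ * ∑ i ∈ Finset.range m, |α i| ≤ ‖∑ i ∈ Finset.range m, α i • e i‖ ∧
      ‖∑ i ∈ Finset.range m, α i • e i‖ ≤ L * ∑ i ∈ Finset.range m, |α i|)

end Prelude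

theorem exists_weakStar_ultralimit {E : Type*} [NormedAddCommGroup E]
    [NormedSpace ℝ E] (U : Ultrafilter ℕ) (f : ℕ → E →L[ℝ] ℝ) (K : ℝ)
    (hf : ∀ n, ‖f n‖ ≤ K) :
    ∃ g : E →L[ℝ] ℝ, ∀ y, Tendsto (fun n => f n y) U (𝓝 (g y)) := by
  obtain ⟨g, -, hg⟩ := (WeakDual.isCompact_closedBall (𝕜 := ℝ) (0 : StrongDual ℝ E) K)
    |>.ultrafilter_le_nhds (U.map fun n => StrongDual.toWeakDual (f n)) (by
      rw [Ultrafilter.coe_map, le_principal_iff, mem_map]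
      refine univ_mem' fun n => ?_
      simpa using hf n)
  refine ⟨WeakDual.toStrongDual g, fun y => ?_⟩
  exact ((WeakDual.eval_continuous y).tendsto g).comp hg

section NormedLattice

variable {E : Type*} [NormedAddCommGroup E] [Lattice E] [HasSolidNorm E] [IsOrderedAddMonoid E]

theorem HasSolidNorm.norm_le_of_nonneg_of_le {y z : E} (hy : 0 ≤ y) (hyz : y ≤ z) :
    ‖y‖ ≤ ‖z‖ :=
  HasSolidNorm.solid (by rwa [abs_of_nonneg hy, abs_of_nonneg (hy.trans hyz)])

theorem HasSolidNorm.norm_posPart_le (y : E) : ‖y⁺‖ ≤ ‖y‖ :=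
  HasSolidNorm.solid (by
    rw [abs_of_nonneg (posPart_nonneg y), ← posPart_add_negPart y]
    exact le_add_of_nonneg_right (negPart_nonneg y))

theorem HasSolidNorm.norm_negPart_le (y : E) : ‖y⁻‖ ≤ ‖y‖ :=
  HasSolidNorm.solid (by
    rw [abs_of_nonneg (negPart_nonneg y), ← posPart_add_negPart y]
    exact le_add_of_nonneg_left (posPart_nonneg y))

variable [NormedSpace ℝ E]

theorem HasSolidNorm.smul_nonneg {r : ℝ} (hr : 0 ≤ r) {y : E} (hy : 0 ≤ y) : 0 ≤ r • y := by
  have half : ∀ n : ℕ, 0 ≤ ((2 : ℝ) ^ n)⁻¹ • y := by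
    intro n
    induction n with
    | zero => simpa using hy
    | succ n ih =>
      apply nsmul_two_semiclosed
      rw [← Nat.cast_smul_eq_nsmul ℝ, smul_smul]
      convert ih using 2
      rw [pow_succ]
      field_simp
      norm_num
  have lim : Tendsto (fun n : ℕ => ((⌊r * 2 ^ n⌋₊ : ℝ) / 2 ^ n) • y) atTop (𝓝 (r • y)) :=
    ((tendsto_nat_floor_mul_div_atTop hr).comp
      (tendsto_pow_atTop_atTop_of_one_lt one_lt_two)).smul_const y
  refine ge_of_tendsto' lim fun n => ?_
  rw [div_eq_mul_inv, ← smul_smul, Nat.cast_smul_eq_nsmul]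
  exact nsmul_nonneg (half n) _

theorem HasSolidNorm.posSMulMono : PosSMulMono ℝ E :=
  ⟨fun r hr a b hab => by
    have := HasSolidNorm.smul_nonneg hr (sub_nonneg.2 hab)
    rwa [smul_sub, sub_nonneg] at this⟩

/-- A function which is additive and norm bounded on the positive cone extends to a continuous
linear functional. -/
theorem exists_clm_of_additive_on_cone (p : E → ℝ) (K : ℝ)
    (hadd : ∀ y z : E, 0 ≤ y → 0 ≤ z → p (y + z) = p y + p z)
    (hp : ∀ y : E, 0 ≤ y → 0 ≤ p y ∧ p y ≤ K * ‖y‖) (hK : 0 ≤ K) :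
    ∃ g : E →L[ℝ] ℝ, (∀ y, 0 ≤ y → g y = p y) ∧ ‖g‖ ≤ K := by
  have hp0 : p 0 = 0 := by simpa using hadd 0 0 le_rfl le_rfl
  let g : E →+ ℝ := AddMonoidHom.mk' (fun y => p y⁺ - p y⁻) (by
    intro y z
    have e : (y + z)⁺ + (y⁻ + z⁻) = (y + z)⁻ + (y⁺ + z⁺) := by
      have h₁ := posPart_sub_negPart (y + z)
      have h₂ := posPart_sub_negPart y
      have h₃ := posPart_sub_negPart z
      rw [← sub_eq_zero]
      calc _ = ((y + z)⁺ - (y + z)⁻) - (y⁺ - y⁻) - (z⁺ - z⁻) := by abel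
        _ = 0 := by rw [h₁, h₂, h₃]; abel
    have e' := congrArg p e
    rw [hadd _ _ (posPart_nonneg _) (add_nonneg (negPart_nonneg _) (negPart_nonneg _)),
      hadd _ _ (negPart_nonneg _) (add_nonneg (posPart_nonneg _) (posPart_nonneg _)),
      hadd _ _ (negPart_nonneg _) (negPart_nonneg _),
      hadd _ _ (posPart_nonneg _) (posPart_nonneg _)] at e'
    linarith)
  have hbound : ∀ y, ‖g y‖ ≤ K * ‖y‖ := by
    intro y
    have h₁ := hp _ (posPart_nonneg y)
    have h₂ := hp _ (negPart_nonneg y)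
    have h₃ := mul_le_mul_of_nonneg_left (HasSolidNorm.norm_posPart_le y) hK
    have h₄ := mul_le_mul_of_nonneg_left (HasSolidNorm.norm_negPart_le y) hK
    change |p y⁺ - p y⁻| ≤ _
    rw [abs_le]
    constructor <;> linarith
  refine ⟨g.toRealLinearMap (AddMonoidHomClass.continuous_of_bound g K hbound), ?_, ?_⟩
  · intro y hy
    change p y⁺ - p y⁻ = p y
    rw [posPart_of_nonneg hy, negPart_of_nonneg hy, hp0, sub_zero]
  · exact ContinuousLinearMap.opNorm_le_bound _ hK hbound

/-- The positive part of a continuous linear functional. -/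
theorem exists_dual_posPart (f : E →L[ℝ] ℝ) :
    ∃ g : E →L[ℝ] ℝ, ‖g‖ ≤ ‖f‖ ∧ (∀ y z, 0 ≤ z → z ≤ y → f z ≤ g y) ∧
      ∀ (c : ℝ) (y : E), 0 ≤ y → (∀ z, 0 ≤ z → z ≤ y → f z ≤ c) → g y ≤ c := by
  let S : E → Set ℝ := fun y => f '' Set.Icc 0 y
  have bdd : ∀ y, BddAbove (S y) := by
    rintro y
    refine ⟨‖f‖ * ‖y‖, ?_⟩
    rintro _ ⟨z, hz, rfl⟩
    exact ((le_abs_self _).trans (f.le_opNorm z)).trans (mul_le_mul_of_nonneg_left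
      (HasSolidNorm.norm_le_of_nonneg_of_le hz.1 hz.2) (norm_nonneg f))
  have ne : ∀ y, 0 ≤ y → (S y).Nonempty := fun y hy => ⟨f 0, 0, ⟨le_rfl, hy⟩, rfl⟩
  have le_sup : ∀ y z, 0 ≤ z → z ≤ y → f z ≤ sSup (S y) := fun y z h₀ h₁ =>
    le_csSup (bdd y) ⟨z, ⟨h₀, h₁⟩, rfl⟩
  have sup_le : ∀ (c : ℝ) (y : E), 0 ≤ y → (∀ z, 0 ≤ z → z ≤ y → f z ≤ c) → sSup (S y) ≤ c := by
    intro c y hy h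
    refine csSup_le (ne y hy) ?_
    rintro _ ⟨z, hz, rfl⟩
    exact h z hz.1 hz.2
  obtain ⟨g, hg, hgf⟩ := exists_clm_of_additive_on_cone (fun y => sSup (S y)) ‖f‖
    (by
      intro y z hy hz
      apply le_antisymm
      · refine sup_le _ _ (add_nonneg hy hz) fun w h₀ h₁ => ?_
        have e : f w = f (w ⊓ y) + f (w - w ⊓ y) := by rw [← map_add]; congr 1; abel
        rw [e]
        refine add_le_add (le_sup _ _ (le_inf h₀ hy) inf_le_right)
          (le_sup _ _ (sub_nonneg.2 inf_le_left) ?_)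
        rw [sub_le_iff_le_add, ← sub_le_iff_le_add']
        exact le_inf (sub_le_self _ hz) (by rwa [sub_le_iff_le_add])
      · rw [← le_sub_iff_add_le]
        refine sup_le _ _ hy fun u h₀ h₁ => ?_
        rw [le_sub_comm]
        refine sup_le _ _ hz fun v h₂ h₃ => ?_
        rw [le_sub_iff_add_le', ← map_add]
        exact le_sup _ _ (add_nonneg h₀ h₂) (add_le_add h₁ h₃))
    (by
      intro y hy
      refine ⟨by simpa using le_sup y 0 le_rfl hy, sup_le _ _ hy fun z h₀ h₁ => ?_⟩
      exact ((le_abs_self _).trans (f.le_opNorm z)).trans (mul_le_mul_of_nonneg_left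
        (HasSolidNorm.norm_le_of_nonneg_of_le h₀ h₁) (norm_nonneg f)))
    (norm_nonneg f)
  refine ⟨g, hgf, fun y z h₀ h₁ => ?_, fun c y hy h => ?_⟩
  · rw [hg y (h₀.trans h₁)]
    exact le_sup y z h₀ h₁
  · rw [hg y hy]
    exact sup_le c y hy h

/-- The modulus of a continuous linear functional. -/
theorem exists_dual_abs (f : E →L[ℝ] ℝ) :
    ∃ g : E →L[ℝ] ℝ, ‖g‖ ≤ 3 * ‖f‖ ∧ (∀ y, |f y| ≤ g |y|) ∧
      ∀ h : E →L[ℝ] ℝ, (∀ y, 0 ≤ y → |f y| ≤ h y) → ∀ y, 0 ≤ y → g y ≤ h y := by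
  obtain ⟨p, hpf, hle, hsup⟩ := exists_dual_posPart f
  refine ⟨(2 : ℝ) • p - f, ?_, fun y => ?_, fun h hh y hy => ?_⟩
  · refine (norm_sub_le _ _).trans ?_
    rw [norm_smul, Real.norm_eq_abs, abs_two]
    linarith
  · have h₁ := hle |y| y⁺ (posPart_nonneg y) (by
      rw [← posPart_add_negPart y]; exact le_add_of_nonneg_right (negPart_nonneg y))
    have h₂ := hle |y| y⁻ (negPart_nonneg y) (by
      rw [← posPart_add_negPart y]; exact le_add_of_nonneg_left (posPart_nonneg y))
    have h₃ : f y = f y⁺ - f y⁻ := by rw [← map_sub, posPart_sub_negPart]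
    have h₄ : f |y| = f y⁺ + f y⁻ := by rw [← map_add, posPart_add_negPart]
    simp only [sub_apply, smul_apply, smul_eq_mul]
    rw [abs_le]
    constructor <;> linarith
  · have : p y ≤ (h y + f y) / 2 := hsup _ y hy fun z h₀ h₁ => by
      have e₁ := (le_abs_self _).trans (hh z h₀)
      have e₂ := (neg_le_abs _).trans (hh (y - z) (sub_nonneg.2 h₁))
      rw [map_sub, map_sub] at e₂
      linarith
    simp only [sub_apply, smul_apply, smul_eq_mul]
    linarith

end NormedLattice

section RegularNorm

set_option linter.unusedSectionVars false

variable {X : Type*} [NormedAddCommGroup X] [Lattice X] [HasSolidNorm X] [IsOrderedAddMonoid X]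
  [NormedSpace ℝ X]

theorem abs_smul_le_of_hasSolidNorm (r : ℝ) (y : X) : |r • y| ≤ |r| • |y| := by
  have : PosSMulMono ℝ X := HasSolidNorm.posSMulMono
  rcases le_total 0 r with hr | hr
  · rw [abs_of_nonneg hr]
    refine abs_le'.2 ⟨smul_le_smul_of_nonneg_left (le_abs_self y) hr, ?_⟩
    rw [← smul_neg]
    exact smul_le_smul_of_nonneg_left (neg_le_abs y) hr
  · rw [abs_of_nonpos hr]
    have hr' : 0 ≤ -r := neg_nonneg.2 hr
    refine abs_le'.2 ⟨?_, ?_⟩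
    · rw [← neg_smul_neg]
      exact smul_le_smul_of_nonneg_left (neg_le_abs y) hr'
    · rw [← neg_smul]
      exact smul_le_smul_of_nonneg_left (le_abs_self y) hr'

theorem abs_sum_le_sum_abs_of_lattice {ι : Type*} (s : Finset ι) (f : ι → X) :
    |∑ i ∈ s, f i| ≤ ∑ i ∈ s, |f i| :=
  Finset.le_sum_of_subadditive (fun y : X => |y|) abs_zero.le abs_add_le s f

theorem abs_sum_smul_le {ι : Type*} (s : Finset ι) (c : ι → ℝ) (f : ι → X) :
    |∑ i ∈ s, c i • f i| ≤ ∑ i ∈ s, |c i| • |f i| :=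
  (abs_sum_le_sum_abs_of_lattice s _).trans
    (Finset.sum_le_sum fun i _ => abs_smul_le_of_hasSolidNorm (c i) (f i))

/-- `T` is dominated, in the sense of the regular norm, by an operator of norm at most `c`. -/
def RegBound (T : X →L[ℝ] X) (c : ℝ) : Prop :=
  ∃ S : X →L[ℝ] X, ‖S‖ ≤ c ∧ ∀ y, |T y| ≤ S |y|

theorem RegBound.mono {T : X →L[ℝ] X} {c d : ℝ} (h : RegBound T c) (hcd : c ≤ d) :
    RegBound T d := by
  obtain ⟨S, hS, hT⟩ := h
  exact ⟨S, hS.trans hcd, hT⟩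

theorem RegBound.add {T T' : X →L[ℝ] X} {c c' : ℝ} (h : RegBound T c) (h' : RegBound T' c') :
    RegBound (T + T') (c + c') := by
  obtain ⟨S, hS, hT⟩ := h
  obtain ⟨S', hS', hT'⟩ := h'
  exact ⟨S + S', (norm_add_le _ _).trans (add_le_add hS hS'),
    fun y => (abs_add_le _ _).trans (add_le_add (hT y) (hT' y))⟩

theorem RegBound.smul {T : X →L[ℝ] X} {c : ℝ} (h : RegBound T c) (r : ℝ) :
    RegBound (r • T) (|r| * c) := by
  have : PosSMulMono ℝ X := HasSolidNorm.posSMulMono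
  obtain ⟨S, hS, hT⟩ := h
  refine ⟨|r| • S, ?_, fun y => (abs_smul_le_of_hasSolidNorm r _).trans
    (smul_le_smul_of_nonneg_left (hT y) (abs_nonneg r))⟩
  rw [norm_smul, Real.norm_eq_abs, abs_abs]
  exact mul_le_mul_of_nonneg_left hS (abs_nonneg r)

theorem RegBound.neg {T : X →L[ℝ] X} {c : ℝ} (h : RegBound T c) : RegBound (-T) c := by
  simpa using h.smul (-1)

theorem RegBound.sub {T T' : X →L[ℝ] X} {c c' : ℝ} (h : RegBound T c) (h' : RegBound T' c') :
    RegBound (T - T') (c + c') := by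
  rw [sub_eq_add_neg]
  exact h.add h'.neg

theorem RegBound.zero : RegBound (0 : X →L[ℝ] X) 0 := ⟨0, by simp, fun y => by simp⟩

theorem RegBound.sum {ι : Type*} (s : Finset ι) {T : ι → X →L[ℝ] X} {c : ι → ℝ}
    (h : ∀ i ∈ s, RegBound (T i) (c i)) : RegBound (∑ i ∈ s, T i) (∑ i ∈ s, c i) := by
  classical
  induction s using Finset.induction_on with
  | empty => simpa using RegBound.zero
  | insert i s hi ih =>
    rw [Finset.sum_insert hi, Finset.sum_insert hi]
    exact (h i (Finset.mem_insert_self i s)).add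
      (ih fun j hj => h j (Finset.mem_insert_of_mem hj))

theorem RegBound.rnorm_le {T : X →L[ℝ] X} {c : ℝ} (h : RegBound T c) : rnorm T ≤ c := by
  obtain ⟨S, hS, hT⟩ := h
  unfold rnorm
  refine (csInf_le ⟨0, ?_⟩ (by exact ⟨S, rfl, hT⟩)).trans hS
  rintro _ ⟨S', rfl, -⟩
  exact norm_nonneg S'

theorem rnorm_nonneg (T : X →L[ℝ] X) : 0 ≤ rnorm T := by
  refine Real.sInf_nonneg ?_
  rintro _ ⟨S, rfl, -⟩
  exact norm_nonneg S

theorem RegBound.exists_of_rnorm_lt {T : X →L[ℝ] X} {c d : ℝ} (h : RegBound T c)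
    (hd : rnorm T < d) : RegBound T d := by
  obtain ⟨S, -, hT⟩ := h
  unfold rnorm at hd
  obtain ⟨_, ⟨S', rfl, hS'⟩, hlt⟩ := exists_lt_of_csInf_lt (by exact ⟨‖S‖, S, rfl, hT⟩) hd
  exact ⟨S', hlt.le, hS'⟩

theorem RegBound.smulRight (f : X →L[ℝ] ℝ) (v : X) :
    RegBound (f.smulRight v) (3 * ‖f‖ * ‖v‖) := by
  have : PosSMulMono ℝ X := HasSolidNorm.posSMulMono
  obtain ⟨g, hg, habs, -⟩ := exists_dual_abs f
  refine ⟨g.smulRight |v|, ?_, fun y => ?_⟩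
  · rw [ContinuousLinearMap.norm_smulRight_apply, norm_abs_eq_norm]
    exact mul_le_mul_of_nonneg_right hg (norm_nonneg v)
  · refine (abs_smul_le_of_hasSolidNorm _ _).trans ?_
    have := HasSolidNorm.smul_nonneg (sub_nonneg.2 (habs y)) (abs_nonneg v)
    rwa [sub_smul, sub_nonneg] at this

theorem IsPosOp.abs_le {T : X →L[ℝ] X} (hT : IsPosOp T) (y : X) : |T y| ≤ T |y| := by
  refine abs_le'.2 ⟨?_, ?_⟩
  · rw [← sub_nonneg, ← map_sub]
    exact hT _ (sub_nonneg.2 (le_abs_self y))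
  · rw [← map_neg, ← sub_nonneg, ← map_sub]
    exact hT _ (sub_nonneg.2 (neg_le_abs y))

theorem IsPosOp.add {S T : X →L[ℝ] X} (hS : IsPosOp S) (hT : IsPosOp T) : IsPosOp (S + T) :=
  fun y hy => add_nonneg (hS y hy) (hT y hy)

theorem IsPosOp.smul {T : X →L[ℝ] X} (hT : IsPosOp T) {r : ℝ} (hr : 0 ≤ r) : IsPosOp (r • T) :=
  fun y hy => HasSolidNorm.smul_nonneg hr (hT y hy)

theorem IsPosOp.sum {ι : Type*} (s : Finset ι) {T : ι → X →L[ℝ] X}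
    (hT : ∀ i ∈ s, IsPosOp (T i)) : IsPosOp (∑ i ∈ s, T i) := by
  intro y hy
  rw [sum_apply]
  exact Finset.sum_nonneg fun i hi => hT i hi y hy

theorem mem_LrSet_iff {T : X →L[ℝ] X} :
    T ∈ LrSet X ↔ ∃ P Q : X →L[ℝ] X, IsPosOp P ∧ IsPosOp Q ∧ T = P - Q := by
  constructor
  · rintro ⟨n, c, S, hS, rfl⟩
    refine ⟨∑ i, (c i)⁺ • S i, ∑ i, (c i)⁻ • S i,
      IsPosOp.sum _ fun i _ => (hS i).smul (posPart_nonneg _),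
      IsPosOp.sum _ fun i _ => (hS i).smul (negPart_nonneg _), ?_⟩
    rw [← Finset.sum_sub_distrib]
    refine Finset.sum_congr rfl fun i _ => ?_
    rw [← sub_smul, posPart_sub_negPart]
  · rintro ⟨P, Q, hP, hQ, rfl⟩
    refine ⟨2, ![1, -1], ![P, Q], ?_, ?_⟩
    · intro i
      fin_cases i
      · exact hP
      · exact hQ
    · simp [Fin.sum_univ_two, sub_eq_add_neg]

theorem LrSet_add {S T : X →L[ℝ] X} (hS : S ∈ LrSet X) (hT : T ∈ LrSet X) : S + T ∈ LrSet X := by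
  obtain ⟨P, Q, hP, hQ, rfl⟩ := mem_LrSet_iff.1 hS
  obtain ⟨P', Q', hP', hQ', rfl⟩ := mem_LrSet_iff.1 hT
  exact mem_LrSet_iff.2 ⟨P + P', Q + Q', hP.add hP', hQ.add hQ', by abel⟩

theorem LrSet_smul {T : X →L[ℝ] X} (hT : T ∈ LrSet X) (r : ℝ) : r • T ∈ LrSet X := by
  obtain ⟨n, c, S, hS, rfl⟩ := hT
  exact ⟨n, fun i => r * c i, S, hS, by simp [Finset.smul_sum, smul_smul]⟩

theorem exists_regBound_of_mem_LrSet {T : X →L[ℝ] X} (hT : T ∈ LrSet X) : ∃ c, RegBound T c := by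
  obtain ⟨P, Q, hP, hQ, rfl⟩ := mem_LrSet_iff.1 hT
  exact ⟨_, RegBound.sub ⟨P, le_rfl, hP.abs_le⟩ ⟨Q, le_rfl, hQ.abs_le⟩⟩

theorem FinRankOp.add {S T : X →L[ℝ] X} (hS : FinRankOp S) (hT : FinRankOp T) :
    FinRankOp (S + T) := by
  obtain ⟨m, f, v, rfl⟩ := hS
  obtain ⟨n, g, w, rfl⟩ := hT
  exact ⟨m + n, Fin.append f g, Fin.append v w, by simp [Fin.sum_univ_add]⟩

theorem FinRankOp.smul {T : X →L[ℝ] X} (hT : FinRankOp T) (r : ℝ) : FinRankOp (r • T) := by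
  obtain ⟨n, f, v, rfl⟩ := hT
  refine ⟨n, f, fun i => r • v i, ?_⟩
  ext y
  simp [Finset.smul_sum, smul_smul, mul_comm]

theorem FinRankOp.exists_regBound {T : X →L[ℝ] X} (hT : FinRankOp T) : ∃ c, RegBound T c := by
  obtain ⟨n, f, v, rfl⟩ := hT
  exact ⟨_, RegBound.sum _ fun i _ => RegBound.smulRight (f i) (v i)⟩

theorem mem_ArSet_iff {T : X →L[ℝ] X} :
    T ∈ ArSet X ↔ T ∈ LrSet X ∧
      ∀ ε : ℝ, 0 < ε → ∃ F : X →L[ℝ] X, FinRankOp F ∧ RegBound (T - F) ε := by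
  refine and_congr_right fun hT => ⟨fun h ε hε => ?_, fun h ε hε => ?_⟩
  · obtain ⟨F, hF, hlt⟩ := h ε hε
    obtain ⟨c, hc⟩ := exists_regBound_of_mem_LrSet hT
    obtain ⟨d, hd⟩ := hF.exists_regBound
    exact ⟨F, hF, (hc.sub hd).exists_of_rnorm_lt hlt⟩
  · obtain ⟨F, hF, hle⟩ := h (ε / 2) (half_pos hε)
    exact ⟨F, hF, hle.rnorm_le.trans_lt (half_lt_self hε)⟩

theorem ArSet_add {S T : X →L[ℝ] X} (hS : S ∈ ArSet X) (hT : T ∈ ArSet X) : S + T ∈ ArSet X := by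
  rw [mem_ArSet_iff] at *
  refine ⟨LrSet_add hS.1 hT.1, fun ε hε => ?_⟩
  obtain ⟨F, hF, hSF⟩ := hS.2 (ε / 2) (half_pos hε)
  obtain ⟨G, hG, hTG⟩ := hT.2 (ε / 2) (half_pos hε)
  refine ⟨F + G, hF.add hG, ?_⟩
  rw [add_sub_add_comm, ← add_halves ε]
  exact hSF.add hTG

theorem ArSet_smul {T : X →L[ℝ] X} (hT : T ∈ ArSet X) (r : ℝ) : r • T ∈ ArSet X := by
  rw [mem_ArSet_iff] at *
  refine ⟨LrSet_smul hT.1 r, fun ε hε => ?_⟩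
  have hr : 0 < |r| + 1 := by positivity
  obtain ⟨F, hF, hTF⟩ := hT.2 (ε / (|r| + 1)) (by positivity)
  refine ⟨r • F, hF.smul r, ?_⟩
  rw [← smul_sub]
  refine (hTF.smul r).mono ?_
  rw [mul_div_assoc', div_le_iff₀ hr]
  nlinarith

theorem ArSet_of_isPosOp_smulRight {f : X →L[ℝ] ℝ} {v : X} (h : IsPosOp (f.smulRight v)) :
    f.smulRight v ∈ ArSet X := by
  refine mem_ArSet_iff.2 ⟨mem_LrSet_iff.2 ⟨_, 0, h, fun y _ => by simp, by simp⟩,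
    fun ε hε => ⟨f.smulRight v, ⟨1, fun _ => f, fun _ => v, by simp⟩, ?_⟩⟩
  rw [sub_self]
  exact RegBound.zero.mono hε.le

theorem ArSet_zero : (0 : X →L[ℝ] X) ∈ ArSet X := by
  simpa using ArSet_of_isPosOp_smulRight (f := (0 : X →L[ℝ] ℝ)) (v := 0) fun y _ => by simp

theorem ArSet_sum {ι : Type*} (s : Finset ι) {T : ι → X →L[ℝ] X} (hT : ∀ i ∈ s, T i ∈ ArSet X) :
    ∑ i ∈ s, T i ∈ ArSet X :=
  Finset.sum_induction T (· ∈ ArSet X) (fun _ _ => ArSet_add) ArSet_zero hT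

theorem map_sum_smul_of_linear_on_ArSet {W ι : Type*} [AddCommGroup W] [Module ℝ W]
    {G : (X →L[ℝ] X) → W}
    (hadd : ∀ a ∈ ArSet X, ∀ b ∈ ArSet X, G (a + b) = G a + G b)
    (hsmul : ∀ r : ℝ, ∀ a ∈ ArSet X, G (r • a) = r • G a)
    (s : Finset ι) (c : ι → ℝ) {T : ι → X →L[ℝ] X} (hT : ∀ i, T i ∈ ArSet X) :
    G (∑ i ∈ s, c i • T i) = ∑ i ∈ s, c i • G (T i) := by
  classical
  induction s using Finset.induction_on with
  | empty => simpa using hsmul 0 0 ArSet_zero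
  | insert i s hi ih =>
    rw [Finset.sum_insert hi, Finset.sum_insert hi, hadd _ (ArSet_smul (hT i) _) _
      (ArSet_sum s fun j _ => ArSet_smul (hT j) _), hsmul _ _ (hT i), ih]

end RegularNorm

section AtomicBasis

set_option linter.unusedSectionVars false

theorem inf_eq_zero_of_add {E : Type*} [AddCommGroup E] [Lattice E] [IsOrderedAddMonoid E]
    {a b c : E} (ha : 0 ≤ a) (hb : 0 ≤ b) (hc : 0 ≤ c) (hac : a ⊓ c = 0) (hbc : b ⊓ c = 0) :
    (a + b) ⊓ c = 0 := by
  refine le_antisymm ?_ (le_inf (add_nonneg ha hb) hc)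
  rw [← hbc]
  refine le_inf ?_ inf_le_right
  calc (a + b) ⊓ c ≤ (a + b) ⊓ (c + b) := inf_le_inf_left _ (le_add_of_nonneg_right hb)
    _ = a ⊓ c + b := (inf_add a c b).symm
    _ = b := by rw [hac, zero_add]

variable {X : Type*} [NormedAddCommGroup X] [Lattice X] [HasSolidNorm X] [IsOrderedAddMonoid X]
  [NormedSpace ℝ X]

theorem smul_inf_eq_zero {a c : X} (ha : 0 ≤ a) (hc : 0 ≤ c) (h : a ⊓ c = 0) {r : ℝ}
    (hr : 0 ≤ r) : (r • a) ⊓ c = 0 := by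
  have hn : ∀ n : ℕ, (n • a) ⊓ c = 0 := by
    intro n
    induction n with
    | zero => simpa using hc
    | succ n ih =>
      rw [succ_nsmul]
      exact inf_eq_zero_of_add (nsmul_nonneg ha n) ha hc ih h
  obtain ⟨n, hrn⟩ := exists_nat_ge r
  refine le_antisymm ?_ (le_inf (HasSolidNorm.smul_nonneg hr ha) hc)
  rw [← hn n]
  refine inf_le_inf_right _ ?_
  rw [← Nat.cast_smul_eq_nsmul ℝ, ← sub_nonneg, ← sub_smul]
  exact HasSolidNorm.smul_nonneg (sub_nonneg.2 hrn) ha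

variable {x : ℕ → X} {xs : ℕ → X →L[ℝ] ℝ}

theorem atoms_inf_eq_zero (hatom : ∀ i, IsNormAtom (x i))
    (hbi : ∀ i j, xs i (x j) = if i = j then (1 : ℝ) else 0) {i j : ℕ} (hij : i ≠ j) :
    x i ⊓ x j = 0 := by
  have h₀ : 0 ≤ x i ⊓ x j := le_inf (hatom i).1.le (hatom j).1.le
  obtain ⟨c, hc⟩ := (hatom i).2.2 _ h₀ inf_le_left
  obtain ⟨d, hd⟩ := (hatom j).2.2 _ h₀ inf_le_right
  have e : c = 0 := by
    have := congrArg (xs i) (hc.symm.trans hd)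
    simpa [hbi, hij] using this
  rw [hc, e, zero_smul]

theorem sum_smul_atoms_inf_eq_zero (hatom : ∀ i, IsNormAtom (x i))
    (hbi : ∀ i j, xs i (x j) = if i = j then (1 : ℝ) else 0) (s : Finset ℕ) {j : ℕ}
    (hj : j ∉ s) (c : ℕ → ℝ) : (∑ i ∈ s, |c i| • x i) ⊓ x j = 0 := by
  induction s using Finset.induction_on with
  | empty => simpa using (hatom j).1.le
  | insert i s hi ih =>
    rw [Finset.mem_insert, not_or] at hj
    rw [Finset.sum_insert hi]
    exact inf_eq_zero_of_add (HasSolidNorm.smul_nonneg (abs_nonneg _) (hatom i).1.le)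
      (Finset.sum_nonneg fun k _ => HasSolidNorm.smul_nonneg (abs_nonneg _) (hatom k).1.le)
      (hatom j).1.le
      (smul_inf_eq_zero (hatom i).1.le (hatom j).1.le
        (atoms_inf_eq_zero hatom hbi (Ne.symm hj.1)) (abs_nonneg _)) (ih hj.2)

theorem coord_nonneg (hatom : ∀ i, IsNormAtom (x i))
    (hbi : ∀ i j, xs i (x j) = if i = j then (1 : ℝ) else 0)
    (hbasis : ∀ y : X, Tendsto (fun n => ∑ i ∈ Finset.range n, xs i y • x i) atTop (𝓝 y))
    (j : ℕ) {y : X} (hy : 0 ≤ y) : 0 ≤ xs j y := by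
  have hmono : PosSMulMono ℝ X := HasSolidNorm.posSMulMono
  by_contra! hneg
  have hs : 0 < -xs j y := neg_pos.2 hneg
  let w : X := y + (-xs j y) • x j
  have hw : xs j w = 0 := by simp [w, hbi]
  have hdisj : ∀ n, |∑ i ∈ Finset.range n, xs i w • x i| ⊓ x j = 0 := by
    intro n
    refine le_antisymm ?_ (le_inf (abs_nonneg _) (hatom j).1.le)
    rw [← sum_smul_atoms_inf_eq_zero hatom hbi ((Finset.range n).erase j)
      (Finset.notMem_erase j _) fun i => xs i w]
    refine inf_le_inf_right _ ((abs_sum_smul_le _ _ _).trans_eq ?_)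
    have habs : ∀ i, |x i| = x i := fun i => abs_of_nonneg (hatom i).1.le
    simp only [habs]
    refine (Finset.sum_subset (Finset.erase_subset _ _) fun i _ hi => ?_).symm
    by_cases hij : i = j
    · simp [hij, hw]
    · simp_all
  have hlim : |w| ⊓ x j = 0 := by
    have hcont : Continuous fun z : X => (z ⊔ -z) ⊓ x j := by fun_prop
    refine tendsto_nhds_unique ((hcont.tendsto w).comp (hbasis w)) ?_
    exact tendsto_const_nhds.congr fun n => (hdisj n).symm
  have hle : (-xs j y) • x j ≤ |w| := (le_add_of_nonneg_left hy).trans (le_abs_self w)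
  have hmin : (min (-xs j y) 1) • x j ≤ |w| ⊓ x j := by
    refine le_inf (le_trans ?_ hle) ?_
    · rw [← sub_nonneg, ← sub_smul]
      exact HasSolidNorm.smul_nonneg (sub_nonneg.2 (min_le_left _ _)) (hatom j).1.le
    · rw [← sub_nonneg]
      nth_rw 1 [← one_smul ℝ (x j)]
      rw [← sub_smul]
      exact HasSolidNorm.smul_nonneg (sub_nonneg.2 (min_le_right _ _)) (hatom j).1.le
  rw [hlim] at hmin
  have hzero : (min (-xs j y) 1) • x j = 0 :=
    le_antisymm hmin (HasSolidNorm.smul_nonneg (le_min hs.le zero_le_one) (hatom j).1.le)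
  rcases smul_eq_zero.1 hzero with h | h
  · exact (lt_min hs one_pos).ne' h
  · exact (hatom j).1.ne' h

/-- `x` is a normalized Schauder basis of positive vectors whose coordinate functionals `xs` are
positive. -/
structure PositiveBasis (x : ℕ → X) (xs : ℕ → X →L[ℝ] ℝ) : Prop where
  nonneg : ∀ i, 0 ≤ x i
  coord_nonneg : ∀ (i : ℕ) (y : X), 0 ≤ y → 0 ≤ xs i y
  biorth : ∀ i j, xs i (x j) = if i = j then (1 : ℝ) else 0
  tendsto : ∀ y : X, Tendsto (fun n => ∑ i ∈ Finset.range n, xs i y • x i) atTop (𝓝 y)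

/-- The rank-one operator `xs p.2 ⊗ x p.1`. -/
def matUnit (x : ℕ → X) (xs : ℕ → X →L[ℝ] ℝ) (p : ℕ × ℕ) : X →L[ℝ] X :=
  (xs p.2).smulRight (x p.1)

/-- The operator with finite matrix `(c (i, j))_{i, j < n}`. -/
def matSum (x : ℕ → X) (xs : ℕ → X →L[ℝ] ℝ) (n : ℕ) (c : ℕ × ℕ → ℝ) : X →L[ℝ] X :=
  ∑ p ∈ Finset.range n ×ˢ Finset.range n, c p • matUnit x xs p

/-- The matrix coefficients of an operator. -/
def matCoeff (x : ℕ → X) (xs : ℕ → X →L[ℝ] ℝ) (T : X →L[ℝ] X) (p : ℕ × ℕ) : ℝ :=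
  xs p.1 (T (x p.2))

theorem matUnit_apply (p : ℕ × ℕ) (y : X) : matUnit x xs p y = xs p.2 y • x p.1 := rfl

theorem matSum_apply (n : ℕ) (c : ℕ × ℕ → ℝ) (y : X) :
    matSum x xs n c y =
      ∑ p ∈ Finset.range n ×ˢ Finset.range n, c p • xs p.2 y • x p.1 := by
  rw [matSum, sum_apply]
  rfl

theorem matCoeff_add (S T : X →L[ℝ] X) :
    matCoeff x xs (S + T) = matCoeff x xs S + matCoeff x xs T := by
  ext p; simp [matCoeff]

theorem matCoeff_smul (r : ℝ) (T : X →L[ℝ] X) :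
    matCoeff x xs (r • T) = r • matCoeff x xs T := by
  ext p; simp [matCoeff]

theorem matSum_add (n : ℕ) (c d : ℕ × ℕ → ℝ) :
    matSum x xs n (c + d) = matSum x xs n c + matSum x xs n d := by
  simp [matSum, add_smul, Finset.sum_add_distrib]

theorem matSum_smul (n : ℕ) (r : ℝ) (c : ℕ × ℕ → ℝ) :
    matSum x xs n (r • c) = r • matSum x xs n c := by
  simp [matSum, Finset.smul_sum, smul_smul]

namespace PositiveBasis

variable (B : PositiveBasis x xs)
include B

theorem matUnit_isPosOp (p : ℕ × ℕ) : IsPosOp (matUnit x xs p) := fun y hy =>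
  HasSolidNorm.smul_nonneg (B.coord_nonneg _ y hy) (B.nonneg _)

theorem matUnit_mem (p : ℕ × ℕ) : matUnit x xs p ∈ ArSet X :=
  ArSet_of_isPosOp_smulRight (B.matUnit_isPosOp p)

theorem matSum_mem (n : ℕ) (c : ℕ × ℕ → ℝ) : matSum x xs n c ∈ ArSet X :=
  ArSet_sum _ fun p _ => ArSet_smul (B.matUnit_mem p) _

theorem matUnit_comp (i j k l : ℕ) :
    matUnit x xs (i, j) ∘L matUnit x xs (k, l) = if j = k then matUnit x xs (i, l) else 0 := by
  ext y
  simp only [ContinuousLinearMap.comp_apply, matUnit_apply, map_smul, B.biorth]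
  split_ifs with h <;> simp [matUnit_apply]

theorem sum_coord_le (n : ℕ) {y : X} (hy : 0 ≤ y) :
    ∑ i ∈ Finset.range n, xs i y • x i ≤ y := by
  refine ge_of_tendsto (B.tendsto y) ?_
  filter_upwards [eventually_ge_atTop n] with m hm
  refine Finset.sum_le_sum_of_subset_of_nonneg (Finset.range_mono hm) fun i _ _ => ?_
  exact HasSolidNorm.smul_nonneg (B.coord_nonneg i y hy) (B.nonneg i)

theorem abs_coord_le (i : ℕ) (y : X) : |xs i y| ≤ xs i |y| := by
  refine abs_le'.2 ⟨?_, ?_⟩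
  · rw [← sub_nonneg, ← map_sub]
    exact B.coord_nonneg _ _ (sub_nonneg.2 (le_abs_self y))
  · rw [← map_neg, ← sub_nonneg, ← map_sub]
    exact B.coord_nonneg _ _ (sub_nonneg.2 (neg_le_abs y))

theorem abs_matCoeff_le {T S : X →L[ℝ] X} (h : ∀ y, |T y| ≤ S |y|) (p : ℕ × ℕ) :
    |matCoeff x xs T p| ≤ matCoeff x xs S p := by
  refine (B.abs_coord_le _ _).trans ?_
  rw [matCoeff, ← sub_nonneg, ← map_sub]
  refine B.coord_nonneg _ _ (sub_nonneg.2 ?_)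
  simpa [abs_of_nonneg (B.nonneg p.2)] using h (x p.2)

theorem abs_matSum_le {S : X →L[ℝ] X} (hS : IsPosOp S) (n : ℕ) {c : ℕ × ℕ → ℝ}
    (hc : ∀ p, |c p| ≤ matCoeff x xs S p) (y : X) : |matSum x xs n c y| ≤ S |y| := by
  have key : |matSum x xs n c y| ≤ ∑ p ∈ Finset.range n ×ˢ Finset.range n,
      (matCoeff x xs S p * xs p.2 |y|) • x p.1 := by
    rw [matSum_apply]
    refine (abs_sum_le_sum_abs_of_lattice _ _).trans (Finset.sum_le_sum fun p _ => ?_)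
    rw [smul_smul]
    refine (abs_smul_le_of_hasSolidNorm _ _).trans ?_
    rw [abs_of_nonneg (B.nonneg p.1), ← sub_nonneg, ← sub_smul]
    refine HasSolidNorm.smul_nonneg (sub_nonneg.2 ?_) (B.nonneg _)
    rw [abs_mul]
    exact mul_le_mul (hc p) (B.abs_coord_le _ _) (abs_nonneg _) ((abs_nonneg _).trans (hc p))
  let z : X := ∑ j ∈ Finset.range n, xs j |y| • x j
  have hz : 0 ≤ z := Finset.sum_nonneg fun i _ =>
    HasSolidNorm.smul_nonneg (B.coord_nonneg i _ (abs_nonneg y)) (B.nonneg i)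
  have e : ∑ p ∈ Finset.range n ×ˢ Finset.range n, (matCoeff x xs S p * xs p.2 |y|) • x p.1 =
      ∑ i ∈ Finset.range n, xs i (S z) • x i := by
    rw [Finset.sum_product]
    refine Finset.sum_congr rfl fun i _ => ?_
    change ∑ j ∈ Finset.range n, (matCoeff x xs S (i, j) * xs j |y|) • x i = _
    rw [← Finset.sum_smul]
    congr 1
    simp only [z, map_sum, map_smul, smul_eq_mul, matCoeff]
    exact Finset.sum_congr rfl fun j _ => mul_comm _ _
  refine key.trans (e.trans_le ((B.sum_coord_le n (hS z hz)).trans ?_))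
  rw [← sub_nonneg, ← map_sub]
  exact hS _ (sub_nonneg.2 (B.sum_coord_le n (abs_nonneg y)))

theorem regBound_matSum {T : X →L[ℝ] X} {r : ℝ} (hT : RegBound T r) (n : ℕ) {c : ℕ × ℕ → ℝ}
    (hc : ∀ p, |c p| ≤ |matCoeff x xs T p|) : RegBound (matSum x xs n c) r := by
  obtain ⟨S, hSr, hS⟩ := hT
  have hpos : IsPosOp S := fun y hy => by
    simpa [abs_of_nonneg hy] using (abs_nonneg _).trans (hS y)
  exact ⟨S, hSr, B.abs_matSum_le hpos n fun p => (hc p).trans (B.abs_matCoeff_le hS p)⟩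

theorem regBound_diag (n : ℕ) {ε : ℕ → ℝ} (hε : ∀ i, |ε i| ≤ 1) :
    RegBound (∑ i ∈ Finset.range n, ε i • matUnit x xs (i, i)) 1 := by
  refine ⟨ContinuousLinearMap.id ℝ X, ContinuousLinearMap.norm_id_le, fun y => ?_⟩
  rw [sum_apply]
  refine (abs_sum_smul_le _ _ _).trans (le_trans (Finset.sum_le_sum fun i _ => ?_)
    (B.sum_coord_le n (abs_nonneg y)))
  have h₁ := (B.matUnit_isPosOp (i, i)).abs_le y
  have h₂ := HasSolidNorm.smul_nonneg (sub_nonneg.2 (hε i)) (abs_nonneg (matUnit x xs (i, i) y))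
  rw [sub_smul, one_smul, sub_nonneg] at h₂
  exact h₂.trans h₁

theorem tendsto_truncation_of_mem_ArSet
    (hshrink : ∀ l : X →L[ℝ] ℝ,
      Tendsto (fun n => ‖l - ∑ i ∈ Finset.range n, l (x i) • xs i‖) atTop (𝓝 0))
    {T : X →L[ℝ] X} (hT : T ∈ ArSet X) {ε : ℝ} (hε : 0 < ε) :
    ∀ᶠ n in atTop, RegBound (T - matSum x xs n (matCoeff x xs T)) ε := by
  obtain ⟨F, ⟨m, f, v, hF⟩, hTF⟩ := (mem_ArSet_iff.1 hT).2 (ε / 4) (by positivity)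
  have hsplit : ∀ n, T - matSum x xs n (matCoeff x xs T) =
      ((T - F) - matSum x xs n (matCoeff x xs (T - F))) +
        (F - matSum x xs n (matCoeff x xs F)) := by
    intro n
    have : matSum x xs n (matCoeff x xs T) =
        matSum x xs n (matCoeff x xs (T - F)) + matSum x xs n (matCoeff x xs F) := by
      rw [← matSum_add, ← matCoeff_add, sub_add_cancel]
    rw [this]
    abel
  let fn : ℕ → Fin m → X →L[ℝ] ℝ := fun n k => ∑ i ∈ Finset.range n, f k (x i) • xs i
  let vn : ℕ → Fin m → X := fun n k => ∑ i ∈ Finset.range n, xs i (v k) • x i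
  let r : ℕ → Fin m → ℝ := fun n k =>
    3 * ‖f k - fn n k‖ * ‖v k‖ + 3 * ‖fn n k‖ * ‖v k - vn n k‖
  have htrunc : ∀ n, matSum x xs n (matCoeff x xs F) = ∑ k, (fn n k).smulRight (vn n k) := by
    intro n
    ext y
    rw [matSum_apply, hF]
    simp only [matCoeff, sum_apply, ContinuousLinearMap.smulRight_apply, map_sum, map_smul,
      fn, vn, smul_apply, smul_eq_mul, Finset.sum_smul, Finset.smul_sum]
    rw [Finset.sum_comm]
    refine Finset.sum_congr rfl fun k _ => ?_
    rw [Finset.sum_product]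
    refine Finset.sum_congr rfl fun i _ => Finset.sum_congr rfl fun j _ => ?_
    simp only [smul_smul]
    congr 1
    ring
  have hbound : ∀ n, RegBound (F - matSum x xs n (matCoeff x xs F)) (∑ k, r n k) := by
    intro n
    rw [htrunc, hF, ← Finset.sum_sub_distrib]
    refine RegBound.sum _ fun k _ => ?_
    have e : (f k).smulRight (v k) - (fn n k).smulRight (vn n k) =
        (f k - fn n k).smulRight (v k) + (fn n k).smulRight (v k - vn n k) := by
      ext y
      simp [sub_smul, smul_sub]
    rw [e]
    exact (RegBound.smulRight _ _).add (RegBound.smulRight _ _)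
  have hlim : Tendsto (fun n => ∑ k, r n k) atTop (𝓝 0) := by
    rw [← Finset.sum_const_zero (s := (Finset.univ : Finset (Fin m)))]
    refine tendsto_finsetSum _ fun k _ => ?_
    have h₁ : Tendsto (fun n => ‖f k - fn n k‖) atTop (𝓝 0) := hshrink (f k)
    have h₂ : Tendsto (fun n => ‖v k - vn n k‖) atTop (𝓝 0) := by
      have := ((B.tendsto (v k)).const_sub (v k)).norm
      simpa using this
    have h₃ : Tendsto (fun n => ‖fn n k‖) atTop (𝓝 ‖f k‖) := by
      have h : Tendsto (fun n => fn n k) atTop (𝓝 (f k)) := by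
        rw [tendsto_iff_norm_sub_tendsto_zero]
        simpa only [norm_sub_rev] using h₁
      exact h.norm
    simpa using ((h₁.const_mul 3).mul_const ‖v k‖).add ((h₃.const_mul 3).mul h₂)
  filter_upwards [hlim.eventually_lt_const (half_pos hε)] with n hn
  rw [hsplit]
  refine ((hTF.sub (B.regBound_matSum hTF n fun _ => le_rfl)).add (hbound n)).mono ?_
  linarith

end PositiveBasis

end AtomicBasis

section Derivation

set_option linter.unusedSectionVars false

theorem exists_signs_sum_diag_le (b : ℕ → ℕ → ℝ) (n : ℕ) :
    ∃ ε : ℕ → ℝ, (∀ i, ε i = 1 ∨ ε i = -1) ∧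
      ∑ i ∈ Finset.range n, b i i ≤
        ∑ i ∈ Finset.range n, ∑ j ∈ Finset.range n, ε i * ε j * b i j := by
  induction n with
  | zero => exact ⟨fun _ => 1, fun _ => Or.inl rfl, by simp⟩
  | succ n ih =>
    obtain ⟨ε, hε, hle⟩ := ih
    let S : ℝ := ∑ i ∈ Finset.range n, ε i * (b i n + b n i)
    obtain ⟨s, hs, hsS⟩ : ∃ s : ℝ, (s = 1 ∨ s = -1) ∧ 0 ≤ s * S := by
      rcases le_total 0 S with h | h
      · exact ⟨1, Or.inl rfl, by simpa using h⟩
      · exact ⟨-1, Or.inr rfl, by simpa using h⟩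
    have hss : s * s = 1 := by rcases hs with rfl | rfl <;> norm_num
    refine ⟨Function.update ε n s, fun i => ?_, ?_⟩
    · by_cases hi : i = n
      · simpa [hi] using hs
      · simpa [hi] using hε i
    · have hne : ∀ i ∈ Finset.range n, Function.update ε n s i = ε i := fun i hi =>
        Function.update_of_ne (Finset.mem_range.1 hi).ne _ _
      have hmain : ∑ i ∈ Finset.range n, ∑ j ∈ Finset.range n,
          Function.update ε n s i * Function.update ε n s j * b i j =
          ∑ i ∈ Finset.range n, ∑ j ∈ Finset.range n, ε i * ε j * b i j :=
        Finset.sum_congr rfl fun i hi => Finset.sum_congr rfl fun j hj => by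
          rw [hne i hi, hne j hj]
      have hcross : ∑ i ∈ Finset.range n, Function.update ε n s i * s * b i n +
          ∑ j ∈ Finset.range n, s * Function.update ε n s j * b n j = s * S := by
        rw [← Finset.sum_add_distrib, Finset.mul_sum]
        refine Finset.sum_congr rfl fun i hi => ?_
        rw [hne i hi]
        ring
      simp only [Finset.sum_range_succ, Finset.sum_add_distrib, Function.update_self, hmain, hss,
        one_mul]
      linarith

/-- Averaging over signs: the diagonal of a double sequence of functionals is controlled by its
signed double sums. -/
theorem norm_sum_diag_le {E : Type*} [NormedAddCommGroup E] [NormedSpace ℝ E]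
    (A : ℕ → ℕ → E →L[ℝ] ℝ) (n : ℕ) {c : ℝ}
    (h : ∀ ε : ℕ → ℝ, (∀ i, |ε i| ≤ 1) →
      ‖∑ i ∈ Finset.range n, ∑ j ∈ Finset.range n, (ε i * ε j) • A i j‖ ≤ c) :
    ‖∑ i ∈ Finset.range n, A i i‖ ≤ c := by
  have key : ∀ y, (∑ i ∈ Finset.range n, A i i) y ≤ c * ‖y‖ := by
    intro y
    obtain ⟨ε, hε, hle⟩ := exists_signs_sum_diag_le (fun i j => A i j y) n
    have hε' : ∀ i, |ε i| ≤ 1 := fun i => by rcases hε i with h | h <;> simp [h]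
    have h₁ := (le_abs_self _).trans
      (ContinuousLinearMap.le_of_opNorm_le _ (h ε hε') y)
    simp only [sum_apply, smul_apply, smul_eq_mul] at h₁ ⊢
    exact hle.trans h₁
  have hc : 0 ≤ c := (norm_nonneg _).trans (h (fun _ => 0) (by simp))
  refine ContinuousLinearMap.opNorm_le_bound _ hc fun y => ?_
  rw [Real.norm_eq_abs, abs_le']
  refine ⟨key y, ?_⟩
  simpa using key (-y)

variable {X W : Type*} [NormedAddCommGroup X] [Lattice X] [HasSolidNorm X] [IsOrderedAddMonoid X]
  [NormedSpace ℝ X]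
  [NormedAddCommGroup W] [Lattice W] [HasSolidNorm W] [IsOrderedAddMonoid W] [NormedSpace ℝ W]

/-- `L` and `R` are the products of the dual of the Banach lattice module over `ArSet X` whose
products are `Ml` and `Mr`. -/
structure DualBimodule (Ml Mr : (X →L[ℝ] X) → W → W)
    (L R : (X →L[ℝ] X) → (W →L[ℝ] ℝ) → (W →L[ℝ] ℝ)) (K : ℝ) : Prop where
  nonneg : 0 ≤ K
  left_lin : ∀ a ∈ ArSet X, ∀ b ∈ ArSet X, ∀ (s t : ℝ) (y : W),
    Ml (s • a + t • b) y = s • Ml a y + t • Ml b y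
  right_lin : ∀ a ∈ ArSet X, ∀ b ∈ ArSet X, ∀ (s t : ℝ) (y : W),
    Mr (s • a + t • b) y = s • Mr a y + t • Mr b y
  left_mul : ∀ a ∈ ArSet X, ∀ b ∈ ArSet X, ∀ y : W, Ml (a ∘L b) y = Ml a (Ml b y)
  right_mul : ∀ a ∈ ArSet X, ∀ b ∈ ArSet X, ∀ y : W, Mr (a ∘L b) y = Mr b (Mr a y)
  left_right : ∀ a ∈ ArSet X, ∀ b ∈ ArSet X, ∀ y : W, Ml a (Mr b y) = Mr b (Ml a y)
  map_nonneg : ∀ a ∈ ArSet X, IsPosOp a → ∀ y : W, 0 ≤ y → 0 ≤ Ml a y ∧ 0 ≤ Mr a y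
  bound : ∀ a ∈ ArSet X, ∀ y : W, ‖Ml a y‖ ≤ K * rnorm a * ‖y‖ ∧ ‖Mr a y‖ ≤ K * rnorm a * ‖y‖
  dual_left : ∀ a ∈ ArSet X, ∀ (f : W →L[ℝ] ℝ) (y : W), L a f y = f (Mr a y)
  dual_right : ∀ a ∈ ArSet X, ∀ (f : W →L[ℝ] ℝ) (y : W), R a f y = f (Ml a y)

/-- `D` is a derivation on `ArSet X`, bounded by `C` for the regular norm. -/
structure BoundedDerivation (L R : (X →L[ℝ] X) → (W →L[ℝ] ℝ) → (W →L[ℝ] ℝ))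
    (D : (X →L[ℝ] X) → (W →L[ℝ] ℝ)) (C : ℝ) : Prop where
  nonneg : 0 ≤ C
  map_add : ∀ a ∈ ArSet X, ∀ b ∈ ArSet X, D (a + b) = D a + D b
  map_smul : ∀ (r : ℝ), ∀ a ∈ ArSet X, D (r • a) = r • D a
  leibniz : ∀ a ∈ ArSet X, ∀ b ∈ ArSet X, D (a ∘L b) = L a (D b) + R b (D a)
  bound : ∀ a ∈ ArSet X, ‖D a‖ ≤ C * rnorm a

variable {Ml Mr : (X →L[ℝ] X) → W → W}
  {L R : (X →L[ℝ] X) → (W →L[ℝ] ℝ) → (W →L[ℝ] ℝ)} {K : ℝ}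
  {D : (X →L[ℝ] X) → (W →L[ℝ] ℝ)} {C : ℝ} {a b : X →L[ℝ] X} {f g : W →L[ℝ] ℝ}

theorem BoundedDerivation.norm_le (δ : BoundedDerivation L R D C) (ha : a ∈ ArSet X) {r : ℝ}
    (hr : RegBound a r) : ‖D a‖ ≤ C * r :=
  (δ.bound a ha).trans (mul_le_mul_of_nonneg_left hr.rnorm_le δ.nonneg)

namespace DualBimodule

variable (H : DualBimodule Ml Mr L R K)
include H

theorem left_add (ha : a ∈ ArSet X) (hb : b ∈ ArSet X) (f : W →L[ℝ] ℝ) :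
    L (a + b) f = L a f + L b f := by
  ext y
  have := H.right_lin a ha b hb 1 1 y
  simp only [one_smul] at this
  simp [H.dual_left _ ha, H.dual_left _ hb, H.dual_left _ (ArSet_add ha hb), this]

theorem right_add (ha : a ∈ ArSet X) (hb : b ∈ ArSet X) (f : W →L[ℝ] ℝ) :
    R (a + b) f = R a f + R b f := by
  ext y
  have := H.left_lin a ha b hb 1 1 y
  simp only [one_smul] at this
  simp [H.dual_right _ ha, H.dual_right _ hb, H.dual_right _ (ArSet_add ha hb), this]

theorem left_smul (ha : a ∈ ArSet X) (r : ℝ) (f : W →L[ℝ] ℝ) : L (r • a) f = r • L a f := by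
  ext y
  have := H.right_lin a ha a ha r 0 y
  simp only [zero_smul, add_zero] at this
  simp [H.dual_left _ ha, H.dual_left _ (ArSet_smul ha r), this]

theorem right_smul (ha : a ∈ ArSet X) (r : ℝ) (f : W →L[ℝ] ℝ) : R (r • a) f = r • R a f := by
  ext y
  have := H.left_lin a ha a ha r 0 y
  simp only [zero_smul, add_zero] at this
  simp [H.dual_right _ ha, H.dual_right _ (ArSet_smul ha r), this]

theorem left_sum_smul {ι : Type*} (s : Finset ι) (c : ι → ℝ) {T : ι → X →L[ℝ] X}
    (hT : ∀ i, T i ∈ ArSet X) (f : W →L[ℝ] ℝ) :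
    L (∑ i ∈ s, c i • T i) f = ∑ i ∈ s, c i • L (T i) f :=
  map_sum_smul_of_linear_on_ArSet (G := fun a => L a f) (fun _ ha _ hb => H.left_add ha hb f)
    (fun r _ ha => H.left_smul ha r f) s c hT

theorem right_sum_smul {ι : Type*} (s : Finset ι) (c : ι → ℝ) {T : ι → X →L[ℝ] X}
    (hT : ∀ i, T i ∈ ArSet X) (f : W →L[ℝ] ℝ) :
    R (∑ i ∈ s, c i • T i) f = ∑ i ∈ s, c i • R (T i) f :=
  map_sum_smul_of_linear_on_ArSet (G := fun a => R a f) (fun _ ha _ hb => H.right_add ha hb f)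
    (fun r _ ha => H.right_smul ha r f) s c hT

theorem left_map_sum_smul (ha : a ∈ ArSet X) {ι : Type*} (s : Finset ι) (c : ι → ℝ)
    (φ : ι → W →L[ℝ] ℝ) : L a (∑ i ∈ s, c i • φ i) = ∑ i ∈ s, c i • L a (φ i) := by
  ext y
  simp [H.dual_left _ ha, sum_apply]

theorem right_map_sum_smul (ha : a ∈ ArSet X) {ι : Type*} (s : Finset ι) (c : ι → ℝ)
    (φ : ι → W →L[ℝ] ℝ) : R a (∑ i ∈ s, c i • φ i) = ∑ i ∈ s, c i • R a (φ i) := by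
  ext y
  simp [H.dual_right _ ha, sum_apply]

theorem left_map_add (ha : a ∈ ArSet X) (f g : W →L[ℝ] ℝ) : L a (f + g) = L a f + L a g := by
  ext y
  simp [H.dual_left _ ha]

theorem left_left (ha : a ∈ ArSet X) (hb : b ∈ ArSet X) (hab : a ∘L b ∈ ArSet X)
    (f : W →L[ℝ] ℝ) : L a (L b f) = L (a ∘L b) f := by
  ext y
  rw [H.dual_left _ ha, H.dual_left _ hb, H.dual_left _ hab, H.right_mul _ ha _ hb]

theorem right_right (ha : a ∈ ArSet X) (hb : b ∈ ArSet X) (hab : a ∘L b ∈ ArSet X)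
    (f : W →L[ℝ] ℝ) : R b (R a f) = R (a ∘L b) f := by
  ext y
  rw [H.dual_right _ hb, H.dual_right _ ha, H.dual_right _ hab, H.left_mul _ ha _ hb]

theorem right_left (ha : a ∈ ArSet X) (hb : b ∈ ArSet X) (f : W →L[ℝ] ℝ) :
    R b (L a f) = L a (R b f) := by
  ext y
  rw [H.dual_right _ hb, H.dual_left _ ha, H.dual_left _ ha, H.dual_right _ hb,
    H.left_right _ hb _ ha]

theorem left_zero (f : W →L[ℝ] ℝ) : L 0 f = 0 := by
  simpa using H.left_smul ArSet_zero 0 f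

theorem right_zero (f : W →L[ℝ] ℝ) : R 0 f = 0 := by
  simpa using H.right_smul ArSet_zero 0 f

theorem norm_left_le (ha : a ∈ ArSet X) {r : ℝ} (hr : RegBound a r) (f : W →L[ℝ] ℝ) :
    ‖L a f‖ ≤ K * r * ‖f‖ := by
  have hKr : K * rnorm a ≤ K * r := mul_le_mul_of_nonneg_left hr.rnorm_le H.nonneg
  have h₀ : 0 ≤ K * r := (mul_nonneg H.nonneg (rnorm_nonneg a)).trans hKr
  refine ContinuousLinearMap.opNorm_le_bound _ (mul_nonneg h₀ (norm_nonneg f)) fun y => ?_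
  rw [H.dual_left _ ha, mul_right_comm, mul_comm _ ‖f‖]
  refine (f.le_opNorm _).trans (mul_le_mul_of_nonneg_left ?_ (norm_nonneg f))
  exact (H.bound a ha y).2.trans (mul_le_mul_of_nonneg_right hKr (norm_nonneg y))

theorem norm_right_le (ha : a ∈ ArSet X) {r : ℝ} (hr : RegBound a r) (f : W →L[ℝ] ℝ) :
    ‖R a f‖ ≤ K * r * ‖f‖ := by
  have hKr : K * rnorm a ≤ K * r := mul_le_mul_of_nonneg_left hr.rnorm_le H.nonneg
  have h₀ : 0 ≤ K * r := (mul_nonneg H.nonneg (rnorm_nonneg a)).trans hKr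
  refine ContinuousLinearMap.opNorm_le_bound _ (mul_nonneg h₀ (norm_nonneg f)) fun y => ?_
  rw [H.dual_right _ ha, mul_right_comm, mul_comm _ ‖f‖]
  refine (f.le_opNorm _).trans (mul_le_mul_of_nonneg_left ?_ (norm_nonneg f))
  exact (H.bound a ha y).1.trans (mul_le_mul_of_nonneg_right hKr (norm_nonneg y))

theorem abs_left_le (ha : a ∈ ArSet X) (hpos : IsPosOp a) (h : ∀ y, 0 ≤ y → |f y| ≤ g y) {y : W}
    (hy : 0 ≤ y) : |L a f y| ≤ L a g y := by
  rw [H.dual_left _ ha, H.dual_left _ ha]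
  exact h _ (H.map_nonneg a ha hpos y hy).2

theorem abs_right_le (ha : a ∈ ArSet X) (hpos : IsPosOp a) (h : ∀ y, 0 ≤ y → |f y| ≤ g y) {y : W}
    (hy : 0 ≤ y) : |R a f y| ≤ R a g y := by
  rw [H.dual_right _ ha, H.dual_right _ ha]
  exact h _ (H.map_nonneg a ha hpos y hy).1

end DualBimodule

/-- The functional `∑_{i < n} L q_i (D q_i)`, where `q_i` is the `i`-th diagonal matrix unit. -/
def diagSum (x : ℕ → X) (xs : ℕ → X →L[ℝ] ℝ) (L : (X →L[ℝ] X) → (W →L[ℝ] ℝ) → (W →L[ℝ] ℝ))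
    (D : (X →L[ℝ] X) → (W →L[ℝ] ℝ)) (n : ℕ) : W →L[ℝ] ℝ :=
  ∑ i ∈ Finset.range n, L (matUnit x xs (i, i)) (D (matUnit x xs (i, i)))

/-- The corner `q_i · D E_ij · q_j` of the value of `D` at the matrix unit `E_ij`. -/
def corner (x : ℕ → X) (xs : ℕ → X →L[ℝ] ℝ) (L R : (X →L[ℝ] X) → (W →L[ℝ] ℝ) → (W →L[ℝ] ℝ))
    (D : (X →L[ℝ] X) → (W →L[ℝ] ℝ)) (p : ℕ × ℕ) : W →L[ℝ] ℝ :=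
  L (matUnit x xs (p.1, p.1)) (R (matUnit x xs (p.2, p.2)) (D (matUnit x xs p)))

variable {x : ℕ → X} {xs : ℕ → X →L[ℝ] ℝ}

namespace PositiveBasis

variable (B : PositiveBasis x xs)
include B

theorem norm_diagSum_left_le (H : DualBimodule Ml Mr L R K) (δ : BoundedDerivation L R D C) (n : ℕ) :
    ‖diagSum x xs L D n‖ ≤ K * C := by
  refine norm_sum_diag_le (fun i j => L (matUnit x xs (i, i)) (D (matUnit x xs (j, j)))) n
    fun ε hε => ?_
  have hq : ∀ i, matUnit x xs (i, i) ∈ ArSet X := fun i => B.matUnit_mem _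
  have hg := ArSet_sum (Finset.range n) fun i _ => ArSet_smul (hq i) (ε i)
  have hb := B.regBound_diag n hε
  have hD := δ.norm_le hg hb
  have hL := H.norm_left_le hg hb (D (∑ i ∈ Finset.range n, ε i • matUnit x xs (i, i)))
  refine le_trans (le_of_eq ?_) (hL.trans ?_)
  · rw [H.left_sum_smul _ _ hq, map_sum_smul_of_linear_on_ArSet δ.map_add δ.map_smul _ _ hq]
    simp only [H.left_map_sum_smul (hq _), Finset.smul_sum, smul_smul]
  · rw [mul_one] at hD ⊢
    exact mul_le_mul_of_nonneg_left hD H.nonneg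

theorem norm_diagSum_right_le (H : DualBimodule Ml Mr L R K) (δ : BoundedDerivation L R D C) (n : ℕ) :
    ‖diagSum x xs R D n‖ ≤ K * C := by
  refine norm_sum_diag_le (fun i j => R (matUnit x xs (i, i)) (D (matUnit x xs (j, j)))) n
    fun ε hε => ?_
  have hq : ∀ i, matUnit x xs (i, i) ∈ ArSet X := fun i => B.matUnit_mem _
  have hg := ArSet_sum (Finset.range n) fun i _ => ArSet_smul (hq i) (ε i)
  have hb := B.regBound_diag n hε
  have hD := δ.norm_le hg hb
  have hR := H.norm_right_le hg hb (D (∑ i ∈ Finset.range n, ε i • matUnit x xs (i, i)))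
  refine le_trans (le_of_eq ?_) (hR.trans ?_)
  · rw [H.right_sum_smul _ _ hq, map_sum_smul_of_linear_on_ArSet δ.map_add δ.map_smul _ _ hq]
    simp only [H.right_map_sum_smul (hq _), Finset.smul_sum, smul_smul]
  · rw [mul_one] at hD ⊢
    exact mul_le_mul_of_nonneg_left hD H.nonneg

theorem comp_matUnit_mem (p q : ℕ × ℕ) : matUnit x xs p ∘L matUnit x xs q ∈ ArSet X := by
  obtain ⟨i, j⟩ := p
  obtain ⟨k, l⟩ := q
  rw [B.matUnit_comp]
  split_ifs
  · exact B.matUnit_mem _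
  · exact ArSet_zero

theorem left_matUnit_diagSum (H : DualBimodule Ml Mr L R K) {n i j : ℕ} (hj : j < n) :
    L (matUnit x xs (i, j)) (diagSum x xs L D n) =
      L (matUnit x xs (i, j)) (D (matUnit x xs (j, j))) := by
  have h := H.left_map_sum_smul (B.matUnit_mem (i, j)) (Finset.range n) (fun _ => 1)
    fun k => L (matUnit x xs (k, k)) (D (matUnit x xs (k, k)))
  simp only [one_smul, H.left_left (B.matUnit_mem _) (B.matUnit_mem _) (B.comp_matUnit_mem _ _),
    B.matUnit_comp] at h
  rw [diagSum, h, Finset.sum_eq_single j]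
  · simp
  · intro k _ hk
    rw [if_neg hk.symm, H.left_zero]
  · simp [hj]

theorem right_matUnit_diagSum (H : DualBimodule Ml Mr L R K) {n i j : ℕ} (hi : i < n) :
    R (matUnit x xs (i, j)) (diagSum x xs R D n) =
      R (matUnit x xs (i, j)) (D (matUnit x xs (i, i))) := by
  have h := H.right_map_sum_smul (B.matUnit_mem (i, j)) (Finset.range n) (fun _ => 1)
    fun k => R (matUnit x xs (k, k)) (D (matUnit x xs (k, k)))
  simp only [one_smul, H.right_right (B.matUnit_mem _) (B.matUnit_mem _) (B.comp_matUnit_mem _ _),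
    B.matUnit_comp] at h
  rw [diagSum, h, Finset.sum_eq_single i]
  · simp
  · intro k _ hk
    rw [if_neg hk, H.right_zero]
  · simp [hi]

theorem derivation_matUnit (H : DualBimodule Ml Mr L R K) (δ : BoundedDerivation L R D C)
    (i j : ℕ) : D (matUnit x xs (i, j)) = corner x xs L R D (i, j) +
      R (matUnit x xs (i, j)) (D (matUnit x xs (i, i))) +
      L (matUnit x xs (i, j)) (D (matUnit x xs (j, j))) := by
  have h₁ := δ.leibniz _ (B.matUnit_mem (i, i)) _ (B.matUnit_mem (i, j))
  have h₂ := δ.leibniz _ (B.matUnit_mem (i, j)) _ (B.matUnit_mem (j, j))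
  have h₃ := H.left_left (B.matUnit_mem (i, i)) (B.matUnit_mem (i, j)) (B.comp_matUnit_mem _ _)
    (D (matUnit x xs (j, j)))
  simp only [B.matUnit_comp, if_true] at h₁ h₂ h₃
  rw [h₁]
  nth_rw 1 [h₂]
  rw [H.left_map_add (B.matUnit_mem _), h₃, corner]
  abel

theorem derivation_matSum (H : DualBimodule Ml Mr L R K) (δ : BoundedDerivation L R D C)
    (n : ℕ) (c : ℕ × ℕ → ℝ) : D (matSum x xs n c) =
      ∑ p ∈ Finset.range n ×ˢ Finset.range n, c p • corner x xs L R D p +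
      R (matSum x xs n c) (diagSum x xs R D n) + L (matSum x xs n c) (diagSum x xs L D n) := by
  rw [matSum, map_sum_smul_of_linear_on_ArSet δ.map_add δ.map_smul _ _ B.matUnit_mem,
    H.left_sum_smul _ _ B.matUnit_mem, H.right_sum_smul _ _ B.matUnit_mem,
    ← Finset.sum_add_distrib, ← Finset.sum_add_distrib]
  refine Finset.sum_congr rfl fun p hp => ?_
  obtain ⟨i, j⟩ := p
  rw [Finset.mem_product, Finset.mem_range, Finset.mem_range] at hp
  rw [B.right_matUnit_diagSum H hp.1, B.left_matUnit_diagSum H hp.2, ← smul_add, ← smul_add,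
    ← B.derivation_matUnit H δ]

theorem corner_corner (H : DualBimodule Ml Mr L R K) (p q : ℕ × ℕ) :
    L (matUnit x xs (p.1, p.1)) (R (matUnit x xs (p.2, p.2)) (corner x xs L R D q)) =
      if q = p then corner x xs L R D p else 0 := by
  obtain ⟨i, j⟩ := p
  obtain ⟨k, l⟩ := q
  have hm := B.matUnit_mem
  rw [corner, H.right_left (hm _) (hm _), H.left_left (hm _) (hm _) (B.comp_matUnit_mem _ _),
    H.right_right (hm _) (hm _) (B.comp_matUnit_mem _ _), B.matUnit_comp, B.matUnit_comp]
  by_cases hik : i = k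
  · by_cases hlj : l = j
    · simp [hik, hlj, corner]
    · rw [if_neg hlj, H.right_zero]
      have : L (if i = k then matUnit x xs (i, k) else 0) (0 : W →L[ℝ] ℝ) = 0 := by
        rw [if_pos hik]
        ext y
        simp [H.dual_left _ (hm _)]
      rw [this, if_neg (by simp [hlj])]
  · rw [if_neg hik, H.left_zero, if_neg (by simp [Ne.symm hik])]

/-- The moduli of the corners, weighted by a nonnegative matrix, are bounded by the regular norm of
the operator with this matrix. -/
theorem sum_corner_modulus_le (H : DualBimodule Ml Mr L R K) (δ : BoundedDerivation L R D C)
    {u : ℕ × ℕ → W →L[ℝ] ℝ}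
    (hu : ∀ p, ∀ h : W →L[ℝ] ℝ, (∀ y, 0 ≤ y → |corner x xs L R D p y| ≤ h y) →
      ∀ y, 0 ≤ y → u p y ≤ h y)
    (n : ℕ) {c : ℕ × ℕ → ℝ} (hc : ∀ p, 0 ≤ c p) {r : ℝ} (hr : RegBound (matSum x xs n c) r)
    {y : W} (hy : 0 ≤ y) :
    ∑ p ∈ Finset.range n ×ˢ Finset.range n, c p * u p y ≤
      K * (K * (3 * (C + 2 * (K * (K * C))))) * r * ‖y‖ := by
  set Δ : W →L[ℝ] ℝ := ∑ p ∈ Finset.range n ×ˢ Finset.range n, c p • corner x xs L R D p with hΔ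
  have hb := B.matSum_mem n c
  have hr₀ : 0 ≤ r := (rnorm_nonneg _).trans hr.rnorm_le
  have hΔle : ‖Δ‖ ≤ (C + 2 * (K * (K * C))) * r := by
    have e : Δ = D (matSum x xs n c) - R (matSum x xs n c) (diagSum x xs R D n) -
        L (matSum x xs n c) (diagSum x xs L D n) := by
      rw [B.derivation_matSum H δ n c]
      abel
    have h₁ := δ.norm_le hb hr
    have hKr : 0 ≤ K * r := mul_nonneg H.nonneg hr₀
    have h₂ := (H.norm_right_le hb hr (diagSum x xs R D n)).trans
      (mul_le_mul_of_nonneg_left (B.norm_diagSum_right_le H δ n) hKr)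
    have h₃ := (H.norm_left_le hb hr (diagSum x xs L D n)).trans
      (mul_le_mul_of_nonneg_left (B.norm_diagSum_left_le H δ n) hKr)
    rw [e]
    refine (norm_sub_le _ _).trans ((add_le_add_left (norm_sub_le _ _) _).trans ?_)
    linarith
  obtain ⟨η, hηle, hη, -⟩ := exists_dual_abs Δ
  have hη' : ∀ y, 0 ≤ y → |Δ y| ≤ η y := fun y hy => by simpa [abs_of_nonneg hy] using hη y
  have hη₀ : ∀ y, 0 ≤ y → |(0 : W →L[ℝ] ℝ) y| ≤ η y := fun y hy => by
    simpa using (abs_nonneg _).trans (hη' y hy)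
  have hm := B.matUnit_mem
  have hpos := B.matUnit_isPosOp
  let κ : ℕ × ℕ → (W →L[ℝ] ℝ) := fun p =>
    L (matUnit x xs (p.1, p.1)) (R (matUnit x xs (p.2, p.2)) η)
  have hterm : ∀ p ∈ Finset.range n ×ˢ Finset.range n, c p * u p y ≤ κ p y := by
    intro p hp
    rcases (hc p).eq_or_lt with h0 | h0
    · rw [← h0, zero_mul]
      exact (abs_nonneg _).trans (H.abs_left_le (hm _) (hpos _)
        (fun z hz => H.abs_right_le (hm _) (hpos _) hη₀ hz) hy)
    · have hcorner : c p • corner x xs L R D p =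
          L (matUnit x xs (p.1, p.1)) (R (matUnit x xs (p.2, p.2)) Δ) := by
        rw [hΔ, H.right_map_sum_smul (hm _), H.left_map_sum_smul (hm _)]
        simp only [B.corner_corner H]
        rw [Finset.sum_eq_single p]
        · simp
        · intro q _ hq
          rw [if_neg hq, smul_zero]
        · exact fun h => absurd hp h
      have hle := hu p ((c p)⁻¹ • κ p) (fun z hz => ?_) y hy
      · rw [smul_apply, smul_eq_mul] at hle
        calc c p * u p y ≤ c p * ((c p)⁻¹ * κ p y) := mul_le_mul_of_nonneg_left hle h0.le
          _ = κ p y := mul_inv_cancel_left₀ h0.ne' _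
      · have h := H.abs_left_le (hm (p.1, p.1)) (hpos _)
          (fun z hz => H.abs_right_le (hm (p.2, p.2)) (hpos _) hη' hz) hz
        rw [← hcorner, smul_apply, smul_eq_mul, abs_mul, abs_of_pos h0] at h
        rw [smul_apply, smul_eq_mul, ← div_eq_inv_mul, le_div_iff₀ h0, mul_comm]
        exact h
  have hsum : ∑ p ∈ Finset.range n ×ˢ Finset.range n, κ p =
      L (∑ i ∈ Finset.range n, (1 : ℝ) • matUnit x xs (i, i))
        (R (∑ i ∈ Finset.range n, (1 : ℝ) • matUnit x xs (i, i)) η) := by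
    rw [H.left_sum_smul _ _ (fun i => hm (i, i)), H.right_sum_smul _ _ (fun i => hm (i, i)),
      Finset.sum_product]
    simp only [H.left_map_sum_smul (hm _)]
    simp only [one_smul, κ]
  have he := ArSet_sum (Finset.range n) fun i _ => ArSet_smul (hm (i, i)) (1 : ℝ)
  have hreg := B.regBound_diag n (ε := fun _ => 1) (by simp)
  have hR := H.norm_right_le he hreg η
  have hL := H.norm_left_le he hreg
    (R (∑ i ∈ Finset.range n, (1 : ℝ) • matUnit x xs (i, i)) η)
  rw [mul_one] at hR hL
  have hκ : ‖∑ p ∈ Finset.range n ×ˢ Finset.range n, κ p‖ ≤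
      K * (K * (3 * (C + 2 * (K * (K * C))))) * r := by
    rw [hsum]
    refine hL.trans ?_
    rw [mul_assoc, mul_assoc]
    refine mul_le_mul_of_nonneg_left (hR.trans (mul_le_mul_of_nonneg_left ?_ H.nonneg)) H.nonneg
    refine hηle.trans ?_
    rw [mul_assoc]
    exact mul_le_mul_of_nonneg_left hΔle (by norm_num)
  calc ∑ p ∈ Finset.range n ×ˢ Finset.range n, c p * u p y
      ≤ ∑ p ∈ Finset.range n ×ˢ Finset.range n, κ p y := Finset.sum_le_sum hterm
    _ = (∑ p ∈ Finset.range n ×ˢ Finset.range n, κ p) y := (sum_apply _ _ _).symm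
    _ ≤ _ := (le_abs_self _).trans (ContinuousLinearMap.le_of_opNorm_le _ hκ y)

end PositiveBasis

/-- A map that is linear on `ArSet X`, and a pointwise limit of maps dominated by a pointwise
bounded sequence of positive linear maps, is regular. -/
theorem regularDerivOn_of_dominated
    (hDadd : ∀ a ∈ ArSet X, ∀ b ∈ ArSet X, D (a + b) = D a + D b)
    (hDsmul : ∀ (r : ℝ), ∀ a ∈ ArSet X, D (r • a) = r • D a)
    (G T : ℕ → (X →L[ℝ] X) → (W →L[ℝ] ℝ))
    (hGadd : ∀ n, ∀ a ∈ ArSet X, ∀ b ∈ ArSet X, G n (a + b) = G n a + G n b)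
    (hGsmul : ∀ n (r : ℝ), ∀ a ∈ ArSet X, G n (r • a) = r • G n a)
    (hGpos : ∀ n, ∀ a ∈ ArSet X, IsPosOp a → dualLe 0 (G n a))
    (hGbdd : ∀ a ∈ ArSet X, ∃ c, ∀ n, ‖G n a‖ ≤ c)
    (hTG : ∀ n, ∀ a ∈ ArSet X, IsPosOp a → dualLe (T n a) (G n a))
    (hT : ∀ a ∈ ArSet X, ∀ y, Tendsto (fun n => T n a y) atTop (𝓝 (D a y))) :
    RegularDerivOn (ArSet X) D := by
  let U : Ultrafilter ℕ := hyperfilter ℕ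
  have hU : (U : Filter ℕ) ≤ atTop := Nat.hyperfilter_le_atTop
  have hlim : ∀ a, ∃ g : W →L[ℝ] ℝ,
      a ∈ ArSet X → ∀ y, Tendsto (fun n => G n a y) U (𝓝 (g y)) := by
    intro a
    by_cases ha : a ∈ ArSet X
    · obtain ⟨c, hc⟩ := hGbdd a ha
      obtain ⟨g, hg⟩ := exists_weakStar_ultralimit U (fun n => G n a) c hc
      exact ⟨g, fun _ => hg⟩
    · exact ⟨0, fun h => absurd h ha⟩
  choose P hP using hlim
  have hPadd : ∀ a ∈ ArSet X, ∀ b ∈ ArSet X, P (a + b) = P a + P b := by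
    intro a ha b hb
    ext y
    refine tendsto_nhds_unique (hP _ (ArSet_add ha hb) y) ?_
    simpa [hGadd _ a ha b hb] using (hP a ha y).add (hP b hb y)
  have hPsmul : ∀ (r : ℝ), ∀ a ∈ ArSet X, P (r • a) = r • P a := by
    intro r a ha
    ext y
    refine tendsto_nhds_unique (hP _ (ArSet_smul ha r) y) ?_
    simpa [hGsmul _ r a ha] using (hP a ha y).const_mul r
  have hPpos : ∀ a ∈ ArSet X, IsPosOp a → dualLe 0 (P a) := fun a ha hpos y hy =>
    ge_of_tendsto' (hP a ha y) fun n => hGpos n a ha hpos y hy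
  have hPD : ∀ a ∈ ArSet X, IsPosOp a → dualLe 0 (P a - D a) := by
    intro a ha hpos y hy
    rw [sub_apply, zero_apply, sub_nonneg]
    exact le_of_tendsto_of_tendsto' ((hT a ha y).mono_left hU) (hP a ha y)
      fun n => hTG n a ha hpos y hy
  refine ⟨2, ![1, -1], ![P, fun a => P a - D a], fun t => ?_, fun a _ => ?_⟩
  · fin_cases t
    · exact ⟨hPadd, hPsmul, hPpos⟩
    · refine ⟨fun a ha b hb => ?_, fun r a ha => ?_, hPD⟩
      · change P (a + b) - D (a + b) = (P a - D a) + (P b - D b)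
        rw [hPadd a ha b hb, hDadd a ha b hb, add_sub_add_comm]
      · change P (r • a) - D (r • a) = r • (P a - D a)
        rw [hPsmul r a ha, hDsmul r a ha, smul_sub]
  · rw [Fin.sum_univ_two]
    change D a = (1 : ℝ) • P a + (-1 : ℝ) • (P a - D a)
    module

theorem PositiveBasis.regularDerivOn (B : PositiveBasis x xs)
    (hshrink : ∀ l : X →L[ℝ] ℝ,
      Tendsto (fun n => ‖l - ∑ i ∈ Finset.range n, l (x i) • xs i‖) atTop (𝓝 0))
    (H : DualBimodule Ml Mr L R K) (δ : BoundedDerivation L R D C) :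
    RegularDerivOn (ArSet X) D := by
  choose u _ huabs hu using fun p => exists_dual_abs (corner x xs L R D p)
  choose φ hφnorm hφabs _ using fun n => exists_dual_abs (diagSum x xs L D n)
  choose ρ hρnorm hρabs _ using fun n => exists_dual_abs (diagSum x xs R D n)
  have cone : ∀ {f g : W →L[ℝ] ℝ}, (∀ y, |f y| ≤ g |y|) → ∀ y, 0 ≤ y → |f y| ≤ g y :=
    fun h y hy => by simpa [abs_of_nonneg hy] using h y
  have hu₀ : ∀ p y, 0 ≤ y → 0 ≤ u p y := fun p y hy =>
    (abs_nonneg _).trans (cone (huabs p) y hy)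
  have huu : ∀ p y, |u p y| ≤ u p |y| := by
    intro p y
    have h₁ := hu₀ p _ (sub_nonneg.2 (le_abs_self y))
    have h₂ := hu₀ p _ (sub_nonneg.2 (neg_le_abs y))
    rw [map_sub, sub_nonneg] at h₁ h₂
    rw [map_neg] at h₂
    exact abs_le'.2 ⟨h₁, h₂⟩
  let b : ℕ → (X →L[ℝ] X) → (X →L[ℝ] X) := fun n a => matSum x xs n (matCoeff x xs a)
  have hb : ∀ n a, b n a ∈ ArSet X := fun n a => B.matSum_mem n _
  have hbadd : ∀ n a a', b n (a + a') = b n a + b n a' := fun n a a' => by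
    simp only [b, matCoeff_add, matSum_add]
  have hbsmul : ∀ n (r : ℝ) a, b n (r • a) = r • b n a := fun n r a => by
    simp only [b, matCoeff_smul, matSum_smul]
  have hcpos : ∀ {a : X →L[ℝ] X}, IsPosOp a → ∀ p, 0 ≤ matCoeff x xs a p := fun h p =>
    B.coord_nonneg _ _ (h _ (B.nonneg _))
  have hbpos : ∀ n a, IsPosOp a → IsPosOp (b n a) := fun n a h =>
    IsPosOp.sum _ fun p _ => (B.matUnit_isPosOp p).smul (hcpos h p)
  let G : ℕ → (X →L[ℝ] X) → (W →L[ℝ] ℝ) := fun n a =>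
    ∑ p ∈ Finset.range n ×ˢ Finset.range n, matCoeff x xs a p • u p +
      R (b n a) (ρ n) + L (b n a) (φ n)
  have hdom : ∀ n a, IsPosOp a → ∀ y, 0 ≤ y → |D (b n a) y| ≤ G n a y := by
    intro n a hpos y hy
    rw [B.derivation_matSum H δ]
    simp only [G, add_apply]
    refine (abs_add_three _ _ _).trans (add_le_add (add_le_add ?_ ?_) ?_)
    · simp only [sum_apply, smul_apply, smul_eq_mul]
      refine (Finset.abs_sum_le_sum_abs _ _).trans (Finset.sum_le_sum fun p _ => ?_)
      rw [abs_mul, abs_of_nonneg (hcpos hpos p)]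
      exact mul_le_mul_of_nonneg_left (cone (huabs p) y hy) (hcpos hpos p)
    · exact H.abs_right_le (hb n a) (hbpos n a hpos) (cone (hρabs n)) hy
    · exact H.abs_left_le (hb n a) (hbpos n a hpos) (cone (hφabs n)) hy
  refine regularDerivOn_of_dominated δ.map_add δ.map_smul G (fun n a => D (b n a)) ?_ ?_ ?_ ?_ ?_ ?_
  · intro n a _ a' _
    simp only [G, hbadd, matCoeff_add, Pi.add_apply, add_smul, Finset.sum_add_distrib,
      H.left_add (hb _ _) (hb _ _), H.right_add (hb _ _) (hb _ _)]
    abel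
  · intro n r a _
    simp only [G, hbsmul, matCoeff_smul, Pi.smul_apply, smul_eq_mul, mul_smul, smul_add,
      Finset.smul_sum, H.left_smul (hb _ _), H.right_smul (hb _ _)]
  · exact fun n a _ hpos y hy => (abs_nonneg _).trans (hdom n a hpos y hy)
  · intro a ha
    obtain ⟨r, hr⟩ := exists_regBound_of_mem_LrSet ha.1
    have hr₀ : 0 ≤ r := (rnorm_nonneg _).trans hr.rnorm_le
    have hbr : ∀ n, RegBound (b n a) r := fun n => B.regBound_matSum hr n fun _ => le_rfl
    let κ : ℝ := K * (K * (3 * (C + 2 * (K * (K * C)))))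
    have hκ : 0 ≤ κ := by
      have h₁ := H.nonneg
      have h₂ := δ.nonneg
      positivity
    have hKr : 0 ≤ K * r := mul_nonneg H.nonneg hr₀
    refine ⟨κ * r + K * r * (3 * (K * C)) + K * r * (3 * (K * C)), fun n => ?_⟩
    refine norm_add₃_le.trans (add_le_add (add_le_add ?_ ?_) ?_)
    · refine ContinuousLinearMap.opNorm_le_bound _ (mul_nonneg hκ hr₀) fun y => ?_
      simp only [sum_apply, smul_apply, smul_eq_mul, Real.norm_eq_abs]
      refine (Finset.abs_sum_le_sum_abs _ _).trans
        (le_trans (Finset.sum_le_sum fun p _ => ?_) ((B.sum_corner_modulus_le H δ hu n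
          (fun p => abs_nonneg (matCoeff x xs a p))
          (B.regBound_matSum hr n fun p => (abs_abs _).le) (abs_nonneg y)).trans_eq ?_))
      · rw [abs_mul]
        exact mul_le_mul_of_nonneg_left (huu p y) (abs_nonneg _)
      · rw [norm_abs_eq_norm]
    · refine (H.norm_right_le (hb n a) (hbr n) _).trans (mul_le_mul_of_nonneg_left ?_ hKr)
      exact (hρnorm n).trans
        (mul_le_mul_of_nonneg_left (B.norm_diagSum_right_le H δ n) (by norm_num))
    · refine (H.norm_left_le (hb n a) (hbr n) _).trans (mul_le_mul_of_nonneg_left ?_ hKr)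
      exact (hφnorm n).trans
        (mul_le_mul_of_nonneg_left (B.norm_diagSum_left_le H δ n) (by norm_num))
  · exact fun n a _ hpos y hy => (le_abs_self _).trans (hdom n a hpos y hy)
  · intro a ha y
    have hD : Tendsto (fun n => D (b n a)) atTop (𝓝 (D a)) := by
      rw [Metric.tendsto_nhds]
      intro ε hε
      have hC : 0 < C + 1 := add_pos_of_nonneg_of_pos δ.nonneg one_pos
      filter_upwards [B.tendsto_truncation_of_mem_ArSet hshrink ha (div_pos hε hC)] with n hn
      have hneg : (-1 : ℝ) • b n a ∈ ArSet X := ArSet_smul (hb n a) _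
      have e : a - b n a = a + (-1 : ℝ) • b n a := by rw [neg_one_smul, sub_eq_add_neg]
      have hDe : D (a - b n a) = D a - D (b n a) := by
        rw [e, δ.map_add _ ha _ hneg, δ.map_smul _ _ (hb n a)]
        module
      have hle := δ.norm_le (by rw [e]; exact ArSet_add ha hneg) hn
      rw [hDe] at hle
      rw [dist_comm, dist_eq_norm]
      refine hle.trans_lt ?_
      rw [mul_div_assoc', div_lt_iff₀ hC]
      linarith
    exact ((ContinuousLinearMap.apply ℝ ℝ y).continuous.tendsto (D a)).comp hD

end Derivation

theorem Ar_derivation_regular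
    {X 𝔛 : Type*} [NormedAddCommGroup X] [Lattice X] [HasSolidNorm X] [IsOrderedAddMonoid X] [NormedSpace ℝ X] [CompleteSpace X]
    [NormedAddCommGroup 𝔛] [Lattice 𝔛] [HasSolidNorm 𝔛] [IsOrderedAddMonoid 𝔛] [NormedSpace ℝ 𝔛] [CompleteSpace 𝔛]
    -- X = (⊕ᵢ Xᵢ)_𝐞 is order complete:
    (hXoc : ∀ S : Set X, S.Nonempty → BddAbove S → ∃ b, IsLUB S b)
    (μ : ℝ) (hμ : 1 ≤ μ)
    -- (x i) is a shrinking basis for X satisfying (⋆) with constant μ in each summand: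
    (x : ℕ → X) (xs : ℕ → X →L[ℝ] ℝ)
    (hstar : StarSummandBasis μ x)
    (hbi : ∀ i j, xs i (x j) = if i = j then (1 : ℝ) else 0)
    (hbasis : ∀ y : X, Tendsto (fun n => ∑ i ∈ Finset.range n, xs i y • x i) atTop (𝓝 y))
    (hshrink : ∀ l : X →L[ℝ] ℝ,
      Tendsto (fun n => ‖l - ∑ i ∈ Finset.range n, l (x i) • xs i‖) atTop (𝓝 0))
    -- 𝔛 is a Banach lattice 𝒜ʳ(X)-module, with actions Ml, Mr and constant M:
    (Ml Mr : (X →L[ℝ] X) → 𝔛 → 𝔛) (M : ℝ)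
    (hMladd : ∀ a ∈ ArSet X, ∀ y₁ y₂ : 𝔛, Ml a (y₁ + y₂) = Ml a y₁ + Ml a y₂)
    (hMradd : ∀ a ∈ ArSet X, ∀ y₁ y₂ : 𝔛, Mr a (y₁ + y₂) = Mr a y₁ + Mr a y₂)
    (hMllin : ∀ a ∈ ArSet X, ∀ b ∈ ArSet X, ∀ (s t : ℝ) (y : 𝔛),
      Ml (s • a + t • b) y = s • Ml a y + t • Ml b y)
    (hMrlin : ∀ a ∈ ArSet X, ∀ b ∈ ArSet X, ∀ (s t : ℝ) (y : 𝔛),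
      Mr (s • a + t • b) y = s • Mr a y + t • Mr b y)
    (hMlmul : ∀ a ∈ ArSet X, ∀ b ∈ ArSet X, ∀ y : 𝔛, Ml (a ∘L b) y = Ml a (Ml b y))
    (hMrmul : ∀ a ∈ ArSet X, ∀ b ∈ ArSet X, ∀ y : 𝔛, Mr (a ∘L b) y = Mr b (Mr a y))
    (hMlr : ∀ a ∈ ArSet X, ∀ b ∈ ArSet X, ∀ y : 𝔛, Ml a (Mr b y) = Mr b (Ml a y))
    (hMpos : ∀ a ∈ ArSet X, IsPosOp a → ∀ y : 𝔛, 0 ≤ y → 0 ≤ Ml a y ∧ 0 ≤ Mr a y)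
    (hMbd : ∀ a ∈ ArSet X, ∀ y : 𝔛,
      ‖Ml a y‖ ≤ M * rnorm a * ‖y‖ ∧ ‖Mr a y‖ ≤ M * rnorm a * ‖y‖)
    -- dual module products on 𝔛′ := 𝔛 →L[ℝ] ℝ :
    (DL DR : (X →L[ℝ] X) → (𝔛 →L[ℝ] ℝ) → (𝔛 →L[ℝ] ℝ))
    (hDL : ∀ a ∈ ArSet X, ∀ (x' : 𝔛 →L[ℝ] ℝ) (y : 𝔛), DL a x' y = x' (Mr a y))
    (hDR : ∀ a ∈ ArSet X, ∀ (x' : 𝔛 →L[ℝ] ℝ) (y : 𝔛), DR a x' y = x' (Ml a y))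
    -- the sequences (x·e_n) and (e_n·x) converge in norm for every x ∈ 𝔛:
    (hconv : ∀ y : 𝔛,
      (∃ ly : 𝔛, Tendsto
        (fun n => Mr (∑ i ∈ Finset.range n, (xs i).smulRight (x i)) y) atTop (𝓝 ly)) ∧
      (∃ ly : 𝔛, Tendsto
        (fun n => Ml (∑ i ∈ Finset.range n, (xs i).smulRight (x i)) y) atTop (𝓝 ly)))
    -- either 𝔛 contains no complemented copy of ℓ₁, or X is reflexive and all the
    -- corner spaces q_i·𝔛′·q_j are finite dimensional:
    (hcases :
      (¬ HasComplementedL1 𝔛) ∨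
      (Function.Surjective (NormedSpace.inclusionInDoubleDual ℝ X) ∧
        ∀ i j : ℕ, ∃ (n : ℕ) (b : Fin n → (𝔛 →L[ℝ] ℝ)),
          ∀ ξ : 𝔛 →L[ℝ] ℝ,
            (∃ x' : 𝔛 →L[ℝ] ℝ,
              ξ = DL ((xs i).smulRight (x i)) (DR ((xs j).smulRight (x j)) x')) →
            ∃ c : Fin n → ℝ, ξ = ∑ t, c t • b t))
    -- D is a bounded derivation from ℒʳ(X) to 𝔛′:
    (D : (X →L[ℝ] X) → (𝔛 →L[ℝ] ℝ))
    (hDadd : ∀ a ∈ ArSet X, ∀ b ∈ ArSet X, D (a + b) = D a + D b)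
    (hDsmul : ∀ (r : ℝ), ∀ a ∈ ArSet X, D (r • a) = r • D a)
    (hDder : ∀ a ∈ ArSet X, ∀ b ∈ ArSet X, D (a ∘L b) = DL a (D b) + DR b (D a))
    (hDbdd : ∃ C : ℝ, ∀ a ∈ ArSet X, ‖D a‖ ≤ C * rnorm a) :
    RegularDerivOn (ArSet X) D := by
  obtain ⟨I, ψ, -, -, -, hatom, -⟩ := hstar
  obtain ⟨C, hC⟩ := hDbdd
  have B : PositiveBasis x xs :=
    ⟨fun i => (hatom i).1.le, fun j _ hy => coord_nonneg hatom hbi hbasis j hy, hbi, hbasis⟩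
  have H : DualBimodule Ml Mr DL DR |M| :=
    { nonneg := abs_nonneg M
      left_lin := hMllin
      right_lin := hMrlin
      left_mul := hMlmul
      right_mul := hMrmul
      left_right := hMlr
      map_nonneg := hMpos
      bound := fun a ha y => by
        have hle : M * rnorm a * ‖y‖ ≤ |M| * rnorm a * ‖y‖ := by
          have := rnorm_nonneg a
          gcongr
          exact le_abs_self M
        exact ⟨(hMbd a ha y).1.trans hle, (hMbd a ha y).2.trans hle⟩
      dual_left := hDL
      dual_right := hDR }
  have δ : BoundedDerivation DL DR D |C| :=
    ⟨abs_nonneg C, hDadd, hDsmul, hDder, fun a ha =>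
      (hC a ha).trans (mul_le_mul_of_nonneg_right (le_abs_self C) (rnorm_nonneg a))⟩
  exact B.regularDerivOn hshrink H δ
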